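/- arXiv:2510.05447 — 2 statements merged into one kernel-verified Lean document; each statement's English description precedes it below -/
import Mathlib

section
/- Let n ≤ m. There exists a constant C_{n,m} > 0 such that for every nonnegative measurable function φ : ℝⁿ → ℝ, ∫_{ℝ^{n×m}} φ(σ↓(M)) dM = C_{n,m} · ∫_{x₁ ≥ x₂ ≥ … ≥ xₙ ≥ 0} φ(x) · ∏_{i=1}^{n} x_i^{m-n} · ∏_{1 ≤ i < j ≤ n} (x_i² - x_j²) dx, where σ↓(M) is the vector of singular values of M in decreasing order and both integrals are with respect to Lebesgue measure. -/
open MeasureTheory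

noncomputable instance matrixMeasureSpace {n m : ℕ} :
    MeasureSpace (Matrix (Fin n) (Fin m) ℝ) :=
  inferInstanceAs (MeasureSpace (Fin n → Fin m → ℝ))

/-- The singular values of an `n × m` matrix (`n ≤ m`), as the square roots of the
eigenvalues of `M Mᵀ`, in an arbitrary order. -/
noncomputable def sv {n m : ℕ} (M : Matrix (Fin n) (Fin m) ℝ) : Fin n → ℝ :=
  fun i => Real.sqrt ((Matrix.isHermitian_mul_conjTranspose_self M).eigenvalues i)

/-- The vector of singular values of `M` arranged in decreasing order. -/
noncomputable def svDecr {n m : ℕ} (M : Matrix (Fin n) (Fin m) ℝ) : Fin n → ℝ :=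
  sv M ∘ Tuple.sort (fun j => -(sv M j))


namespace SVF

/-- values at the naturals of the monic polynomial with roots `l` -/
def evl {n : ℕ} (l : Fin n → ℝ) : ℕ → ℝ := fun t => ∏ i, ((t : ℝ) - l i)

/-- the closed chamber -/
def Ch (n : ℕ) : Set (Fin n → ℝ) := {l | Antitone l}

lemma isClosed_Ch (n : ℕ) : IsClosed (Ch n) := by
  have : Ch n = ⋂ i : Fin n, ⋂ j : Fin n, ⋂ _ : i ≤ j, {l | l j ≤ l i} := by
    ext l; simp only [Ch, Set.mem_ofPred_eq, Set.mem_iInter]; rfl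
  rw [this]
  refine isClosed_iInter fun i => isClosed_iInter fun j => isClosed_iInter fun _ =>
    isClosed_le (continuous_apply _) (continuous_apply _)

lemma antitone_eq_of_multiset {n : ℕ} {l l' : Fin n → ℝ} (h : Antitone l) (h' : Antitone l')
    (hm : (Finset.univ : Finset (Fin n)).val.map l = (Finset.univ : Finset (Fin n)).val.map l') :
    l = l' := by
  have h1 : List.ofFn l = List.ofFn l' := by
    apply List.Perm.eq_of_pairwise' (r := (· ≥ ·))
    · exact h.sortedGE_ofFn.pairwise
    · exact h'.sortedGE_ofFn.pairwise
    · rw [← Multiset.coe_eq_coe]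
      simpa [Fin.univ_val_map] using hm
  exact List.ofFn_injective h1

open Polynomial in
lemma multiset_eq_of_evl {n : ℕ} {l l' : Fin n → ℝ} (hm : evl l = evl l') :
    (Finset.univ : Finset (Fin n)).val.map l = (Finset.univ : Finset (Fin n)).val.map l' := by
  have key : (∏ i, (X - C (l i))) = ∏ i, (X - C (l' i)) := by
    apply Polynomial.eq_of_infinite_eval_eq
    refine (Set.infinite_range_of_injective (Nat.cast_injective (R := ℝ))).mono ?_
    rintro _ ⟨t, rfl⟩
    have := congrFun hm t
    simpa [evl, Polynomial.eval_prod] using this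
  have h2 := congrArg Polynomial.roots key
  have h3 : ∀ l : Fin n → ℝ, (∏ i, (X - C (l i))).roots = Finset.univ.val.map l := by
    intro l
    have := Polynomial.roots_multiset_prod_X_sub_C ((Finset.univ : Finset (Fin n)).val.map l)
    rw [Multiset.map_map] at this
    exact this
  rwa [h3, h3] at h2

lemma evl_injOn (n : ℕ) : Set.InjOn (evl (n := n)) (Ch n) := by
  intro l hl l' hl' h
  exact antitone_eq_of_multiset hl hl' (multiset_eq_of_evl h)

lemma continuous_evl (n : ℕ) : Continuous (evl (n := n)) := by
  unfold evl; fun_prop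

lemma exists_q (n : ℕ) : ∃ q : (ℕ → ℝ) → (Fin n → ℝ), Measurable q ∧ ∀ l ∈ Ch n, q (evl l) = l := by
  have h := ContinuousOn.measurableEmbedding (isClosed_Ch n).measurableSet
    (continuous_evl n).continuousOn (evl_injOn n)
  obtain ⟨q, hq, hq'⟩ := h.exists_measurable_extend (g := fun l : Ch n => (l : Fin n → ℝ))
    measurable_subtype_coe (fun _ => inferInstance)
  exact ⟨q, hq, fun l hl => congrFun hq' ⟨l, hl⟩⟩

noncomputable def qf (n : ℕ) : (ℕ → ℝ) → (Fin n → ℝ) := (exists_q n).choose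
lemma measurable_qf (n : ℕ) : Measurable (qf n) := (exists_q n).choose_spec.1
lemma qf_evl {n : ℕ} {l : Fin n → ℝ} (hl : Antitone l) : qf n (evl l) = l :=
  (exists_q n).choose_spec.2 l hl

open Matrix

abbrev Mx (n : ℕ) := Matrix (Fin n) (Fin n) ℝ

def dets {n : ℕ} (A : Mx n) : ℕ → ℝ := fun t => (((t : ℝ) • (1 : Mx n)) - A).det

/-- decreasing eigenvalues (of a matrix similar to a real diagonal one) -/
noncomputable def ev {n : ℕ} (A : Mx n) : Fin n → ℝ := qf n (dets A)

lemma dets_diagonal {n : ℕ} (l : Fin n → ℝ) : dets (diagonal l) = evl l := by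
  funext t
  simp only [dets, evl, smul_one_eq_diagonal, diagonal_sub, det_diagonal]

lemma dets_similar {n : ℕ} (A B K : Mx n) (hK : K.det ≠ 0) (h : A * K = K * B) :
    dets A = dets B := by
  funext t
  have : (((t : ℝ) • (1 : Mx n)) - A) * K = K * (((t : ℝ) • (1 : Mx n)) - B) := by
    rw [sub_mul, mul_sub, h]; simp
  have := congrArg Matrix.det this
  rw [det_mul, det_mul, mul_comm] at this
  exact mul_left_cancel₀ hK this

lemma ev_eq {n : ℕ} (A K : Mx n) (l : Fin n → ℝ) (hl : Antitone l) (hK : K.det ≠ 0)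
    (h : A * K = K * diagonal l) : ev A = l := by
  rw [ev, dets_similar A _ K hK h, dets_diagonal, qf_evl hl]

lemma ev_similar {n : ℕ} (A B K : Mx n) (hK : K.det ≠ 0) (h : A * K = K * B) :
    ev A = ev B := by
  rw [ev, ev, dets_similar A B K hK h]

lemma measurable_dets_comp {n : ℕ} {α : Type*} [MeasurableSpace α] (f : α → Mx n)
    (hf : ∀ i j, Measurable fun x => f x i j) : Measurable fun x => ev (f x) := by
  refine (measurable_qf n).comp ?_
  refine measurable_pi_lambda _ fun t => ?_
  simp only [dets, det_apply]
  refine Finset.measurable_sum _ fun s _ => ?_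
  refine Measurable.const_smul ?_ _
  refine Finset.measurable_prod _ fun i _ => ?_
  simp only [Matrix.sub_apply, Matrix.smul_apply]
  exact measurable_const.sub (hf _ _)

/-- spectral theorem, sorted -/
lemma exists_spectral {n : ℕ} (A : Mx n) (hA : Aᵀ = A) :
    ∃ (U : Mx n) (l : Fin n → ℝ), U * Uᵀ = 1 ∧ Uᵀ * U = 1 ∧ Antitone l ∧ A = U * diagonal l * Uᵀ := by
  have hH : A.IsHermitian := by rw [IsHermitian, conjTranspose_eq_transpose_of_trivial]; exact hA
  have hs := hH.spectral_theorem
  set U0 : Mx n := (hH.eigenvectorUnitary : Mx n)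
  have hU1 : U0 * U0ᵀ = 1 := by
    have := (Unitary.mem_iff.1 hH.eigenvectorUnitary.2).2
    simpa [star_eq_conjTranspose, conjTranspose_eq_transpose_of_trivial] using this
  have hs' : A = U0 * diagonal hH.eigenvalues * U0ᵀ := by
    rw [Unitary.conjStarAlgAut_apply] at hs
    simpa [star_eq_conjTranspose, conjTranspose_eq_transpose_of_trivial, Function.comp_def] using hs
  let s := Tuple.sort (fun j => -(hH.eigenvalues j))
  refine ⟨U0.submatrix id s, hH.eigenvalues ∘ s, ?_, ?_, ?_, ?_⟩
  · rw [transpose_submatrix, submatrix_mul_equiv, hU1]; simp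
  · rw [transpose_submatrix]
    have : U0ᵀ * U0 = 1 := mul_eq_one_comm.1 hU1
    rw [← submatrix_mul _ _ _ _ _ Function.bijective_id, this]
    exact submatrix_one_equiv s
  · have := Tuple.monotone_sort (fun j => -(hH.eigenvalues j))
    intro i j hij
    have := this hij
    simp only [Function.comp_apply] at this
    simpa [s] using this
  · conv_lhs => rw [hs']
    have : diagonal (hH.eigenvalues ∘ s) = (diagonal hH.eigenvalues).submatrix s s := by
      rw [submatrix_diagonal_equiv]
    rw [this, transpose_submatrix, submatrix_mul_equiv, submatrix_mul_equiv, submatrix_id_id]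

lemma det_ne_zero_of_orth {n : ℕ} {U : Mx n} (h : U * Uᵀ = 1) : U.det ≠ 0 := by
  intro h0
  have := congrArg Matrix.det h
  rw [det_mul, h0] at this
  simp at this

lemma ev_spec {n : ℕ} (A : Mx n) (hA : Aᵀ = A) : ∃ U : Mx n, U * Uᵀ = 1 ∧ Uᵀ * U = 1 ∧
    Antitone (ev A) ∧ A = U * diagonal (ev A) * Uᵀ := by
  obtain ⟨U, l, h1, h2, h3, h4⟩ := exists_spectral A hA
  have : ev A = l := by
    refine ev_eq A U l h3 (det_ne_zero_of_orth h1) ?_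
    rw [h4, mul_assoc, h2, mul_one]
  rw [this]
  exact ⟨U, h1, h2, h3, h4⟩

/-- symmetric positive definite matrices via eigenvalues -/
def PDm {n : ℕ} (A : Mx n) : Prop := Aᵀ = A ∧ ∀ i, 0 < ev A i

lemma exists_root {n : ℕ} (A : Mx n) (hA : PDm A) : ∃ r : Mx n, r.det ≠ 0 ∧ A = r * rᵀ := by
  obtain ⟨U, h1, h2, h3, h4⟩ := ev_spec A hA.1
  refine ⟨U * diagonal (fun i => Real.sqrt (ev A i)), ?_, ?_⟩
  · rw [det_mul, det_diagonal]
    exact mul_ne_zero (det_ne_zero_of_orth h1)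
      (Finset.prod_ne_zero_iff.2 fun i _ => (Real.sqrt_pos.2 (hA.2 i)).ne')
  · rw [transpose_mul, diagonal_transpose]
    have : diagonal (fun i => Real.sqrt (ev A i)) * diagonal (fun i => Real.sqrt (ev A i)) =
        diagonal (ev A) := by
      rw [diagonal_mul_diagonal]; congr 1; funext i; exact Real.mul_self_sqrt (hA.2 i).le
    conv_lhs => rw [h4, ← this]
    simp only [mul_assoc]

lemma mul_transpose_self_nonneg {n m : ℕ} (M : Matrix (Fin n) (Fin m) ℝ) (i : Fin n) :
    0 ≤ ev (M * Mᵀ) i := by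
  have hs : (M * Mᵀ)ᵀ = M * Mᵀ := by rw [transpose_mul, transpose_transpose]
  obtain ⟨U, h1, h2, h3, h4⟩ := ev_spec (M * Mᵀ) hs
  have : diagonal (ev (M * Mᵀ)) = (Uᵀ * M) * (Uᵀ * M)ᵀ := by
    calc diagonal (ev (M * Mᵀ)) = (Uᵀ * U) * diagonal (ev (M * Mᵀ)) * (Uᵀ * U) := by rw [h2]; simp
      _ = Uᵀ * (U * diagonal (ev (M * Mᵀ)) * Uᵀ) * U := by simp only [mul_assoc]
      _ = _ := by rw [← h4]; simp only [transpose_mul, transpose_transpose, Matrix.mul_assoc]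
  have h5 := congrFun (congrFun this i) i
  rw [diagonal_apply_eq, mul_apply] at h5
  rw [h5]
  exact Finset.sum_nonneg fun k _ => by rw [transpose_apply]; exact mul_self_nonneg _

lemma det_eq_prod_ev {n : ℕ} (A : Mx n) (hA : Aᵀ = A) : A.det = ∏ i, ev A i := by
  obtain ⟨U, h1, h2, h3, h4⟩ := ev_spec A hA
  conv_lhs => rw [h4]
  rw [det_mul, det_mul, mul_comm, ← mul_assoc, ← det_mul, h2, det_one, one_mul, det_diagonal]

lemma PDm_mul_transpose {n m : ℕ} (M : Matrix (Fin n) (Fin m) ℝ) (h : (M * Mᵀ).det ≠ 0) :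
    PDm (M * Mᵀ) := by
  have hs : (M * Mᵀ)ᵀ = M * Mᵀ := by rw [transpose_mul, transpose_transpose]
  refine ⟨hs, fun i => lt_of_le_of_ne (mul_transpose_self_nonneg M i) fun h0 => h ?_⟩
  rw [det_eq_prod_ev _ hs]
  exact Finset.prod_eq_zero (Finset.mem_univ i) h0.symm

/-- a character of matrices is a power of det once this holds on diagonal matrices -/
lemma char_eq {n : ℕ} (χ : Mx n →* ℝ) (k : ℕ) (h : ∀ d : Fin n → ℝ, χ (diagonal d) = (∏ i, d i) ^ k)
    (g : Mx n) : χ g = g.det ^ k := by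
  induction g using diagonal_transvection_induction with
  | hdiag D _ => rw [h, det_diagonal]
  | htransvec t =>
    obtain ⟨i, j, hij, c⟩ := t
    simp only [TransvectionStruct.toMatrix]
    rw [det_transvection_of_ne _ _ hij, one_pow]
    have h1 : χ (transvection i j c) ≠ 0 := by
      intro h0
      have := congrArg χ (transvection_mul_transvection_same i j hij c (-c))
      rw [map_mul, h0, zero_mul, add_neg_cancel, transvection_zero, map_one] at this
      exact zero_ne_one this
    have h2 : diagonal (Function.update (1 : Fin n → ℝ) i 2) * transvection i j c =
        transvection i j c * transvection i j c * diagonal (Function.update (1 : Fin n → ℝ) i 2) := by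
      rw [transvection_mul_transvection_same i j hij]
      ext a b
      rw [diagonal_mul, mul_diagonal]
      simp only [transvection, Matrix.add_apply, Matrix.one_apply, Matrix.single_apply]
      by_cases ha : a = i
      · subst ha
        by_cases hb : b = a
        · subst hb; simp [hij.symm]
        · simp only [Function.update_self, Function.update_of_ne hb, Pi.one_apply]
          simp [Ne.symm hb, two_mul]
      · by_cases hab : a = b
        · subst hab; simp [Function.update_of_ne ha, Ne.symm ha]
        · simp [Function.update_of_ne ha, Ne.symm ha, hab]
    have h3 := congrArg χ h2
    rw [map_mul, map_mul, map_mul, h] at h3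
    have h4 : (∏ l, Function.update (1 : Fin n → ℝ) i 2 l) ^ k ≠ 0 := by
      refine pow_ne_zero _ (Finset.prod_ne_zero_iff.2 fun l _ => ?_)
      by_cases hl : l = i
      · subst hl; simp
      · simp [Function.update_of_ne hl]
    rw [mul_comm] at h3
    have h5 := mul_right_cancel₀ h4 h3
    have h6 : χ (transvection i j c) * 1 = χ (transvection i j c) * χ (transvection i j c) := by
      rw [mul_one]; exact h5
    exact (mul_left_cancel₀ h1 h6).symm
  | hmul A B hA hB => rw [map_mul, hA, hB, det_mul, mul_pow]

end SVF


namespace SVF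
open Matrix

abbrev E (n m : ℕ) := Fin n → Fin m → ℝ

lemma lint_lin {V : Type*} [NormedAddCommGroup V] [NormedSpace ℝ V] [FiniteDimensional ℝ V]
    [MeasurableSpace V] [BorelSpace V] (μ : Measure V) [μ.IsAddHaarMeasure] (f : V →ₗ[ℝ] V)
    (hf : LinearMap.det f ≠ 0) (F : V → ENNReal) (hF : Measurable F) :
    ∫⁻ x, F x ∂μ = ENNReal.ofReal |LinearMap.det f| * ∫⁻ x, F (f x) ∂μ := by
  have h := Measure.map_linearMap_addHaar_eq_smul_addHaar μ hf
  have hm : Measurable f := f.continuous_of_finiteDimensional.measurable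
  rw [← lintegral_map hF hm, h, lintegral_smul_measure, smul_eq_mul, ← mul_assoc,
    ← ENNReal.ofReal_mul (abs_nonneg _), ← abs_mul, mul_inv_cancel₀ hf]
  simp

def mulL {n m : ℕ} (g : E n n) (M : E n m) : E n m := of.symm (of g * of M)
def gram {n m : ℕ} (M : E n m) : E n n := of.symm (of M * (of M)ᵀ)
noncomputable def dt {n : ℕ} (g : E n n) : ℝ := (of g).det
noncomputable def inv' {n : ℕ} (g : E n n) : E n n := of.symm (of g)⁻¹

def leftHom (n m : ℕ) : Mx n →* Module.End ℝ (E n m) where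
  toFun g :=
    { toFun := fun M => of.symm (g * of M)
      map_add' := fun M N => by rw [← of_add_of, Matrix.mul_add]; rfl
      map_smul' := fun c M => by rw [← smul_of, Matrix.mul_smul]; rfl }
  map_one' := by ext; simp
  map_mul' g h := by
    apply LinearMap.ext; intro M
    show of.symm (g * h * of M) = of.symm (g * of (of.symm (h * of M)))
    rw [Equiv.apply_symm_apply, Matrix.mul_assoc]

lemma det_leftHom (n m : ℕ) (g : Mx n) : LinearMap.det (leftHom n m g) = g.det ^ m := by
  refine char_eq ((LinearMap.det : (E n m →ₗ[ℝ] E n m) →* ℝ).comp (leftHom n m)) m (fun d => ?_) g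
  show LinearMap.det (leftHom n m (diagonal d)) = _
  have : leftHom n m (diagonal d) = LinearMap.pi
      (fun i => (d i • (LinearMap.id : (Fin m → ℝ) →ₗ[ℝ] (Fin m → ℝ))).comp (LinearMap.proj i)) := by
    apply LinearMap.ext; intro M; funext i j
    show (diagonal d * of M) i j = _
    rw [diagonal_mul]; rfl
  rw [this, LinearMap.det_pi]
  simp [LinearMap.det_smul, Finset.prod_pow]

def rightHom (n : ℕ) : Mx n →* Module.End ℝ (E n n) where
  toFun g :=
    { toFun := fun M => of.symm (of M * gᵀ)
      map_add' := fun M N => by rw [← of_add_of, Matrix.add_mul]; rfl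
      map_smul' := fun c M => by rw [← smul_of, Matrix.smul_mul]; rfl }
  map_one' := by ext; simp
  map_mul' g h := by
    apply LinearMap.ext; intro M
    show of.symm (of M * (g * h)ᵀ) = of.symm (of (of.symm (of M * hᵀ)) * gᵀ)
    rw [Equiv.apply_symm_apply, Matrix.mul_assoc, transpose_mul]

lemma det_rightHom (n : ℕ) (g : Mx n) : LinearMap.det (rightHom n g) = g.det ^ n := by
  refine char_eq ((LinearMap.det : (E n n →ₗ[ℝ] E n n) →* ℝ).comp (rightHom n)) n (fun d => ?_) g
  show LinearMap.det (rightHom n (diagonal d)) = _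
  have : rightHom n (diagonal d) = LinearMap.pi
      (fun i => (LinearMap.pi (fun j => (d j • (LinearMap.id : ℝ →ₗ[ℝ] ℝ)).comp (LinearMap.proj j))
         : (Fin n → ℝ) →ₗ[ℝ] (Fin n → ℝ)).comp (LinearMap.proj i)) := by
    apply LinearMap.ext; intro M; funext i j
    show (of M * (diagonal d)ᵀ) i j = d j * M i j
    rw [diagonal_transpose, mul_diagonal, mul_comm]; rfl
  rw [this, LinearMap.det_pi]
  simp only [LinearMap.det_pi, LinearMap.det_smul]
  simp

lemma lint_left {n m : ℕ} (g : E n n) (hg : dt g ≠ 0) (F : E n m → ENNReal) (hF : Measurable F) :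
    ∫⁻ M, F M = ENNReal.ofReal (|dt g| ^ m) * ∫⁻ M, F (mulL g M) := by
  have := lint_lin volume (leftHom n m (of g)) (by rw [det_leftHom]; exact pow_ne_zero _ hg) F hF
  rw [det_leftHom, abs_pow] at this
  exact this

lemma lint_right {n : ℕ} (g : E n n) (hg : dt g ≠ 0) (F : E n n → ENNReal) (hF : Measurable F) :
    ∫⁻ M, F M = ENNReal.ofReal (|dt g| ^ n) * ∫⁻ M, F (mulL M g) := by
  have := lint_lin volume (rightHom n (of g)ᵀ)
    (by rw [det_rightHom, det_transpose]; exact pow_ne_zero _ hg) F hF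
  rw [det_rightHom, det_transpose, abs_pow] at this
  have h2 : ∀ M : E n n, rightHom n (of g)ᵀ M = mulL M g := fun M => by
    show of.symm (of M * (of g)ᵀᵀ) = _
    rw [transpose_transpose]; rfl
  simp only [h2] at this
  exact this

/-! measurability -/
lemma continuous_gram (n m : ℕ) : Continuous (gram (n := n) (m := m)) := by
  refine continuous_pi fun i => continuous_pi fun j => ?_
  simp only [gram, of_symm_apply, mul_apply, transpose_apply, of_apply]
  fun_prop
lemma continuous_dt (n : ℕ) : Continuous (dt (n := n)) := by
  unfold dt
  simp only [det_apply, of_apply]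
  fun_prop
lemma continuous_mulL (n m : ℕ) :
    Continuous (fun p : E n n × E n m => mulL p.1 p.2) := by
  refine continuous_pi fun i => continuous_pi fun j => ?_
  simp only [mulL, of_symm_apply, mul_apply, of_apply]
  fun_prop
lemma measurable_inv' (n : ℕ) : Measurable (inv' (n := n)) := by
  refine measurable_pi_lambda _ fun i => measurable_pi_lambda _ fun j => ?_
  have : (fun g : E n n => inv' g i j) = fun g => (dt g)⁻¹ * (of g).adjugate i j := by
    funext g
    simp [inv', inv_def, dt]
  rw [this]
  refine (continuous_dt n).measurable.inv.mul ?_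
  apply Continuous.measurable
  simp only [adjugate_apply]
  simp only [det_apply, updateRow_apply, of_apply]
  refine continuous_finsetSum _ fun s _ => Continuous.const_smul (continuous_finsetProd _ fun a _ => ?_) _
  split_ifs <;> fun_prop

lemma null_dt (n m : ℕ) (hnm : n ≤ m) : ∀ᵐ M : E n m, dt (gram M) ≠ 0 := by
  let sub : E n m → E n n := fun M i j => M i (Fin.castLE hnm j)
  have hsub : Continuous sub := by
    refine continuous_pi fun i => continuous_pi fun j => ?_
    simp only [sub]; fun_prop
  have h1 : ∀ M : E n m, dt (gram M) = 0 → dt (sub M) = 0 := by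
    intro M h
    obtain ⟨v, hv, hv'⟩ := exists_vecMul_eq_zero_iff.2 h
    refine exists_vecMul_eq_zero_iff.1 ⟨v, hv, ?_⟩
    have h0 : v ᵥ* (of M) = 0 := by
      have : v ᵥ* (of M * (of M)ᵀ) ⬝ᵥ v = 0 := by
        have h2 : v ᵥ* (of M * (of M)ᵀ) = 0 := hv'
        rw [h2, zero_dotProduct]
      rw [← vecMul_vecMul, vecMul_transpose, dotProduct_comm, dotProduct_mulVec] at this
      exact dotProduct_self_eq_zero.1 this
    funext j
    exact congrFun h0 (Fin.castLE hnm j)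
  let N : Set (E n m) := {M | dt (sub M) = 0}
  have hN : MeasurableSet N :=
    (isClosed_singleton.preimage ((continuous_dt n).comp hsub)).measurableSet
  suffices h : volume N = 0 by
    rw [ae_iff]
    refine measure_mono_null (fun M hM => h1 M (by simpa using hM)) h
  let M0 : E n m := fun i j => if i.val = j.val then 1 else 0
  have hfin : ∀ M : E n m, volume {t : ℝ | M + t • M0 ∈ N} = 0 := by
    intro M
    refine Set.Finite.measure_zero (Set.Finite.subset
      ((-(of (sub M))).charpoly.roots.toFinset.finite_toSet) ?_) _
    intro t ht
    have : dt (sub (M + t • M0)) = (-(of (sub M))).charpoly.eval t := by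
      rw [eval_charpoly, dt]
      congr 1
      ext i j
      simp only [sub, M0, of_apply, scalar_apply, Matrix.sub_apply, Matrix.neg_apply, diagonal_apply,
        Pi.add_apply, Pi.smul_apply, Fin.val_castLE, smul_eq_mul, Fin.ext_iff]
      split_ifs <;> ring
    simp only [Finset.mem_coe, Multiset.mem_toFinset]
    rw [Polynomial.mem_roots (charpoly_monic _).ne_zero, Polynomial.IsRoot, ← this]
    exact ht
  have hmeas : Measurable (fun p : ℝ × E n m => N.indicator (1 : E n m → ENNReal) (p.2 + p.1 • M0)) := by
    refine (measurable_one.indicator hN).comp ?_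
    fun_prop
  have h2 : ∫⁻ t in Set.Icc (0:ℝ) 1, ∫⁻ M : E n m, N.indicator (1 : E n m → ENNReal) (M + t • M0)
      = volume N := by
    have : ∀ t : ℝ, ∫⁻ M : E n m, N.indicator (1 : E n m → ENNReal) (M + t • M0) = volume N := by
      intro t
      rw [lintegral_add_right_eq_self (μ := (volume : Measure (E n m))) (N.indicator 1) (t • M0),
        lintegral_indicator_one hN]
    simp [this]
  rw [← h2, lintegral_lintegral_swap (hmeas.aemeasurable)]
  have h3 : ∀ M : E n m, ∫⁻ t in Set.Icc (0:ℝ) 1, N.indicator (1 : E n m → ENNReal) (M + t • M0) = 0 := by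
    intro M
    refine le_antisymm ((lintegral_mono' Measure.restrict_le_self le_rfl).trans ?_) (zero_le)
    have : (fun t : ℝ => N.indicator (1 : E n m → ENNReal) (M + t • M0)) =
        {t : ℝ | M + t • M0 ∈ N}.indicator 1 := by
      funext t; simp [Set.indicator]
    rw [this, lintegral_indicator_one, hfin M]
    exact (by fun_prop : Measurable fun t : ℝ => M + t • M0) hN
  simp [h3]

end SVF


namespace SVF
open Matrix

lemma dt_mulL {n : ℕ} (g h : E n n) : dt (mulL g h) = dt g * dt h := by
  simp [dt, mulL]
lemma dt_gram {n : ℕ} (g : E n n) : dt (gram g) = dt g ^ 2 := by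
  simp [dt, gram, sq]
lemma gram_mulL_congr {n m k : ℕ} (g : E n n) (M : E n m) (r : E n k) (h : gram M = gram r) :
    gram (mulL g M) = gram (mulL g r) := by
  have h' : of M * (of M)ᵀ = of r * (of r)ᵀ := h
  show of.symm ((of g * of M) * (of g * of M)ᵀ) = of.symm ((of g * of r) * (of g * of r)ᵀ)
  rw [transpose_mul, transpose_mul]
  have e1 : ∀ {k : ℕ} (M : Matrix (Fin n) (Fin k) ℝ), of g * M * (Mᵀ * (of g)ᵀ) =
     of g * (M * Mᵀ) * (of g)ᵀ := fun M => by simp only [Matrix.mul_assoc]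
  rw [e1, e1, h']
lemma mulL_inv_mulL {n m : ℕ} (g : E n n) (hg : dt g ≠ 0) (M : E n m) :
    mulL (inv' g) (mulL g M) = M := by
  show of.symm ((of g)⁻¹ * (of g * of M)) = M
  rw [nonsing_inv_mul_cancel_left _ _ (isUnit_iff_ne_zero.2 hg)]; rfl
lemma inv'_mulL {n : ℕ} (r g : E n n) (hr : dt r ≠ 0) :
    mulL (inv' (mulL r g)) r = inv' g := by
  show of.symm ((of r * of g)⁻¹ * of r) = of.symm (of g)⁻¹
  rw [Matrix.mul_inv_rev, Matrix.mul_assoc, nonsing_inv_mul _ (isUnit_iff_ne_zero.2 hr), Matrix.mul_one]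

lemma exists_root_gram {n m : ℕ} (M : E n m) (h : dt (gram M) ≠ 0) :
    ∃ r : E n n, dt r ≠ 0 ∧ gram M = gram r := by
  obtain ⟨r, hr, h⟩ := exists_root _ (PDm_mul_transpose (of M) h)
  exact ⟨of.symm r, hr, h⟩

/-- the auxiliary cut-off -/
def hset (n : ℕ) : Set (E n n) :=
  {S | dt S ≠ 0 ∧ (∑ i, inv' S i i) ≤ n + 1 ∧ dt S ≤ 2}

lemma measurableSet_hset (n : ℕ) : MeasurableSet (hset n) := by
  have h1 := (continuous_dt n).measurable
  have h2 : Measurable fun S : E n n => ∑ i, inv' S i i := by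
    refine Finset.measurable_sum _ fun i _ => ?_
    exact ((measurable_pi_apply i).comp ((measurable_pi_apply i).comp (measurable_inv' n)))
  exact (h1 (measurableSet_singleton 0).compl).inter
    ((measurableSet_le h2 measurable_const).inter (measurableSet_le h1 measurable_const))

noncomputable def hh (n : ℕ) : E n n → ENNReal := (hset n).indicator 1
lemma measurable_hh (n : ℕ) : Measurable (hh n) := measurable_one.indicator (measurableSet_hset n)

noncomputable def ch (n : ℕ) : ENNReal :=
  ∫⁻ g : E n n, (ENNReal.ofReal (|dt g| ^ n))⁻¹ * hh n (gram (inv' g))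

lemma gram_inv_mem {n : ℕ} (g : E n n) (hg : dt g ≠ 0) :
    gram (inv' g) ∈ hset n ↔ (∑ i, ∑ j, g i j ^ 2) ≤ n + 1 ∧ 1 ≤ 2 * dt g ^ 2 := by
  have hu : IsUnit (of g).det := isUnit_iff_ne_zero.2 hg
  have h1 : dt (gram (inv' g)) = (dt g ^ 2)⁻¹ := by
    rw [dt_gram]
    simp [dt, inv', det_nonsing_inv]
  have h2 : inv' (gram (inv' g)) = of.symm ((of g)ᵀ * of g) := by
    show of.symm ((of g)⁻¹ * ((of g)⁻¹)ᵀ)⁻¹ = _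
    rw [Matrix.mul_inv_rev, transpose_nonsing_inv, nonsing_inv_nonsing_inv _ (by rwa [det_transpose]),
      nonsing_inv_nonsing_inv _ hu]
  have h3 : 0 < dt g ^ 2 := by positivity
  show (dt (gram (inv' g)) ≠ 0 ∧ (∑ i, inv' (gram (inv' g)) i i) ≤ n + 1 ∧ dt (gram (inv' g)) ≤ 2) ↔ _
  rw [h1, h2]
  have h4 : (∑ i, (of.symm ((of g)ᵀ * of g)) i i) = ∑ i, ∑ j, g i j ^ 2 := by
    rw [Finset.sum_comm]
    refine Finset.sum_congr rfl fun i _ => ?_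
    show ((of g)ᵀ * of g) i i = _
    rw [mul_apply]
    exact Finset.sum_congr rfl fun j _ => by simp [sq]
  rw [h4, inv_le_iff_one_le_mul₀ h3]
  constructor
  · rintro ⟨_, h, h'⟩; exact ⟨h, h'⟩
  · rintro ⟨h, h'⟩; exact ⟨(inv_pos.2 h3).ne', h, h'⟩

lemma volume_ball_finite {n m : ℕ} (c : ℝ) :
    volume {g : E n m | (∑ i, ∑ j, g i j ^ 2) ≤ c} < ⊤ := by
  have : {g : E n m | (∑ i, ∑ j, g i j ^ 2) ≤ c} ⊆ Metric.closedBall 0 (c + 1) := by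
    intro g hg
    have hg : (∑ i, ∑ j, g i j ^ 2) ≤ c := hg
    have hc : 0 ≤ c := le_trans (Finset.sum_nonneg fun i _ => Finset.sum_nonneg fun j _ => sq_nonneg _) hg
    rw [mem_closedBall_zero_iff, pi_norm_le_iff_of_nonneg (by linarith)]
    intro i
    rw [pi_norm_le_iff_of_nonneg (by linarith)]
    intro j
    have h1 : g i j ^ 2 ≤ ∑ j, g i j ^ 2 :=
      Finset.single_le_sum (f := fun j => g i j ^ 2) (fun j _ => sq_nonneg _) (Finset.mem_univ j)
    have h2 : (∑ j, g i j ^ 2) ≤ ∑ i, ∑ j, g i j ^ 2 :=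
      Finset.single_le_sum (f := fun i => ∑ j, g i j ^ 2)
        (fun i _ => Finset.sum_nonneg fun j _ => sq_nonneg _) (Finset.mem_univ i)
    rw [Real.norm_eq_abs]
    refine abs_le_of_sq_le_sq ?_ (by linarith)
    nlinarith
  exact lt_of_le_of_lt (measure_mono this) measure_closedBall_lt_top

lemma ch_ne_top (n : ℕ) : ch n ≠ ⊤ := by
  have hb : ∀ g : E n n, (ENNReal.ofReal (|dt g| ^ n))⁻¹ * hh n (gram (inv' g)) ≤
     {g : E n n | (∑ i, ∑ j, g i j ^ 2) ≤ n + 1}.indicator (fun _ => (2 : ENNReal) ^ n) g +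
     {g : E n n | dt g = 0}.indicator (fun _ => ⊤) g := by
    intro g
    by_cases hg : dt g = 0
    · rw [Set.indicator_of_mem (s := {g : E n n | dt g = 0}) hg]; simp
    · by_cases hm : gram (inv' g) ∈ hset n
      · have h := (gram_inv_mem g hg).1 hm
        rw [Set.indicator_of_mem (s := {g : E n n | (∑ i, ∑ j, g i j ^ 2) ≤ n + 1}) h.1, hh,
          Set.indicator_of_mem hm]
        refine le_trans ?_ le_self_add
        simp only [Pi.one_apply, mul_one]
        rw [ENNReal.inv_le_iff_inv_le, ENNReal.inv_pow]
        have : (2:ENNReal)⁻¹ = ENNReal.ofReal (1/2) := by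
          rw [one_div, ENNReal.ofReal_inv_of_pos two_pos]; simp
        rw [this, ← ENNReal.ofReal_pow (by norm_num)]
        refine ENNReal.ofReal_le_ofReal (pow_le_pow_left₀ (by norm_num) ?_ n)
        have h2 := h.2
        rw [← sq_abs] at h2
        nlinarith [abs_nonneg (dt g)]
      · rw [hh, Set.indicator_of_notMem hm]; simp
  have hae : ∀ᵐ g : E n n, dt g ≠ 0 := by
    filter_upwards [null_dt n n le_rfl] with g hg h0
    rw [dt_gram, h0] at hg; simp at hg
  have hz : volume {g : E n n | dt g = 0} = 0 := by
    simpa [ae_iff] using hae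
  refine ne_top_of_le_ne_top ?_ (lintegral_mono hb)
  have hm1 : MeasurableSet {g : E n n | dt g = 0} :=
    (continuous_dt n).measurable (measurableSet_singleton 0)
  have hm2 : MeasurableSet {g : E n n | (∑ i, ∑ j, g i j ^ 2) ≤ (n:ℝ) + 1} :=
    (isClosed_le (by fun_prop) continuous_const).measurableSet
  rw [lintegral_add_right _ (measurable_const.indicator hm1), lintegral_indicator hm1,
    lintegral_indicator hm2]
  simp only [lintegral_const, Measure.restrict_apply MeasurableSet.univ, Set.univ_inter, hz, mul_zero, add_zero]
  exact ENNReal.mul_ne_top (by simp) (volume_ball_finite _).ne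

lemma ch_ne_zero (n : ℕ) : ch n ≠ 0 := by
  let O : Set (E n n) := {g | (∑ i, ∑ j, g i j ^ 2) < n + 1 ∧ 1 < 2 * dt g ^ 2}
  have hO : IsOpen O := by
    have hc : Continuous fun g : E n n => ∑ i, ∑ j, g i j ^ 2 := by fun_prop
    have hc2 : Continuous fun g : E n n => 2 * dt g ^ 2 :=
      continuous_const.mul ((continuous_dt n).pow 2)
    exact (isOpen_lt hc continuous_const).inter (isOpen_lt continuous_const hc2)
  have hne : O.Nonempty := by
    refine ⟨of.symm (1 : Mx n), ?_, ?_⟩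
    · have : (∑ i, ∑ j, (of.symm (1 : Mx n)) i j ^ 2) = (n:ℝ) := by
        simp [of_symm_apply, one_apply]
      rw [this]; linarith
    · simp [dt]
  have hpos := hO.measure_pos volume hne
  intro h0
  have hle : ∫⁻ g in O, (ENNReal.ofReal (|dt g| ^ n))⁻¹ * hh n (gram (inv' g)) = 0 :=
    le_antisymm ((setLIntegral_le_lintegral _ _).trans h0.le) zero_le
  have hms : Measurable fun g : E n n => (ENNReal.ofReal (|dt g| ^ n))⁻¹ * hh n (gram (inv' g)) := by
    have := (continuous_dt n).measurable
    refine Measurable.mul (by fun_prop) ?_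
    exact (measurable_hh n).comp ((continuous_gram n n).measurable.comp (measurable_inv' n))
  rw [lintegral_eq_zero_iff hms, Filter.EventuallyEq, ae_restrict_iff' hO.measurableSet] at hle
  have : volume O = 0 := by
    refine measure_mono_null ?_ (ae_iff.1 hle)
    intro g hg hcon
    have hcon := hcon hg
    have hd : dt g ≠ 0 := by
      intro h; have := hg.2; rw [h] at this; norm_num at this
    rw [hh, Set.indicator_of_mem ((gram_inv_mem g hd).2 ⟨hg.1.le, hg.2.le⟩)] at hcon
    simp at hcon
  exact hpos.ne' this

theorem partA (n m : ℕ) (hnm : n ≤ m) : ∃ c1 : ENNReal, ∀ F : E n n → ENNReal, Measurable F →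
    ch n * ∫⁻ M : E n m, F (gram M) =
      c1 * ∫⁻ g : E n n, F (gram g) * ENNReal.ofReal (|dt g| ^ (m - n)) := by
  refine ⟨∫⁻ M : E n m, hh n (gram M) * (ENNReal.ofReal (Real.sqrt (dt (gram M)) ^ m))⁻¹,
    fun F hF => ?_⟩
  have mdt := (continuous_dt n).measurable
  have mgm := (continuous_gram n m).measurable
  have mgn := (continuous_gram n n).measurable
  have mL := (continuous_mulL n m).measurable
  have mLn := (continuous_mulL n n).measurable
  have mh := measurable_hh n
  have mi := measurable_inv' n
  set I := ∫⁻ g : E n n, F (gram g) * ENNReal.ofReal (|dt g| ^ (m - n)) with hI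
  -- first evaluation
  have hD1 : ∫⁻ M : E n m, ∫⁻ g : E n n, F (gram (mulL g M)) * ENNReal.ofReal (|dt g| ^ (m - n)) *
      hh n (gram M) = (∫⁻ M : E n m, hh n (gram M) *
        (ENNReal.ofReal (Real.sqrt (dt (gram M)) ^ m))⁻¹) * I := by
    rw [← lintegral_mul_const _ (by fun_prop)]
    refine lintegral_congr fun M => ?_
    by_cases hM : dt (gram M) = 0
    · have : hh n (gram M) = 0 := by
        rw [hh, Set.indicator_of_notMem]; exact fun h => h.1 hM
      simp [this]
    obtain ⟨r, hr, hMr⟩ := exists_root_gram M hM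
    rw [lintegral_mul_const _ (by fun_prop)]
    have e1 : I = ENNReal.ofReal (|dt r| ^ m) *
        ∫⁻ g : E n n, F (gram (mulL g M)) * ENNReal.ofReal (|dt g| ^ (m - n)) := by
      rw [hI, lint_right r hr _ (by fun_prop)]
      have : ∀ g : E n n, F (gram (mulL g r)) * ENNReal.ofReal (|dt (mulL g r)| ^ (m - n)) =
          ENNReal.ofReal (|dt r| ^ (m - n)) *
          (F (gram (mulL g M)) * ENNReal.ofReal (|dt g| ^ (m - n))) := by
        intro g
        rw [gram_mulL_congr g M r hMr, dt_mulL, abs_mul, mul_pow, ENNReal.ofReal_mul (by positivity)]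
        ring
      simp only [this]
      rw [lintegral_const_mul _ (by fun_prop), ← mul_assoc, ← ENNReal.ofReal_mul (by positivity),
        ← pow_add, Nat.add_sub_cancel' hnm]
    have e2 : Real.sqrt (dt (gram M)) = |dt r| := by
      rw [hMr, dt_gram, Real.sqrt_sq_eq_abs]
    have e3 : ENNReal.ofReal (|dt r| ^ m) ≠ 0 := by
      have : 0 < |dt r| ^ m := by positivity
      exact (ENNReal.ofReal_pos.2 this).ne'
    rw [e2, e1, mul_assoc, ← mul_assoc _ _ (∫⁻ g : E n n, _), ENNReal.inv_mul_cancel e3 (by simp),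
      one_mul, mul_comm]
  have hD2 : ∫⁻ g : E n n, ∫⁻ M : E n m, F (gram (mulL g M)) * ENNReal.ofReal (|dt g| ^ (m - n)) *
      hh n (gram M) = ch n * ∫⁻ M : E n m, F (gram M) := by
    have hae : ∀ᵐ g : E n n, dt g ≠ 0 := by
      filter_upwards [null_dt n n le_rfl] with g hg h0
      rw [dt_gram, h0] at hg; simp at hg
    have s1 : ∀ᵐ g : E n n, ∫⁻ M : E n m, F (gram (mulL g M)) * ENNReal.ofReal (|dt g| ^ (m - n)) *
      hh n (gram M) = ∫⁻ M : E n m, F (gram M) * ((ENNReal.ofReal (|dt g| ^ n))⁻¹ *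
        hh n (gram (mulL (inv' g) M))) := by
      filter_upwards [hae] with g hg
      have e1 := lint_left g hg (fun M : E n m => F (gram M) * ((ENNReal.ofReal (|dt g| ^ n))⁻¹ *
        hh n (gram (mulL (inv' g) M)))) (by fun_prop)
      rw [e1, ← lintegral_const_mul _ (by fun_prop)]
      refine lintegral_congr fun M => ?_
      rw [mulL_inv_mulL g hg]
      have e4 : |dt g| ^ m = |dt g| ^ (m - n) * |dt g| ^ n := by
        rw [← pow_add, Nat.sub_add_cancel hnm]
      rw [e4, ENNReal.ofReal_mul (by positivity)]
      have e3 : ENNReal.ofReal (|dt g| ^ n) ≠ 0 := by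
        have : 0 < |dt g| ^ n := by positivity
        exact (ENNReal.ofReal_pos.2 this).ne'
      calc _ = ENNReal.ofReal (|dt g| ^ (m - n)) * F (gram (mulL g M)) * hh n (gram M) *
             (ENNReal.ofReal (|dt g| ^ n) * (ENNReal.ofReal (|dt g| ^ n))⁻¹) := by
              rw [ENNReal.mul_inv_cancel e3 (by simp)]; ring
        _ = _ := by ring
    rw [lintegral_congr_ae s1, lintegral_lintegral_swap (by
      refine Measurable.aemeasurable ?_
      simp only [Function.uncurry_def]
      fun_prop), ← lintegral_const_mul _ (by fun_prop)]
    refine lintegral_congr_ae ?_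
    filter_upwards [null_dt n m hnm] with M hM
    obtain ⟨r, hr, hMr⟩ := exists_root_gram M hM
    rw [lintegral_const_mul _ (by fun_prop), mul_comm]
    congr 1
    have e1 := lint_left r hr (fun g : E n n => (ENNReal.ofReal (|dt g| ^ n))⁻¹ *
        hh n (gram (mulL (inv' g) M))) (by fun_prop)
    rw [e1, ← lintegral_const_mul _ (by fun_prop), ch]
    refine lintegral_congr fun g => ?_
    rw [gram_mulL_congr _ M r hMr, inv'_mulL r g hr, dt_mulL, abs_mul, mul_pow,
      ENNReal.ofReal_mul (by positivity), ENNReal.mul_inv (by simp) (by simp), ← mul_assoc, ← mul_assoc,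
      ENNReal.mul_inv_cancel, one_mul]
    · have : 0 < |dt r| ^ n := by positivity
      exact (ENNReal.ofReal_pos.2 this).ne'
    · simp
  rw [← hD1, ← hD2, lintegral_lintegral_swap]
  refine Measurable.aemeasurable ?_
  simp only [Function.uncurry_def]
  fun_prop

end SVF


namespace SVF
open Matrix

abbrev Sy (n : ℕ) := Sym2 (Fin n) → ℝ
abbrev V1 (n : ℕ) := E n n × (Fin n → ℝ)
abbrev W1 (n : ℕ) := Sy n × Sy n

def mt {n : ℕ} (S : Sy n) : Mx n := of fun i j => S s(i, j)
def sy {n : ℕ} (A : Mx n) : Sy n := fun z => A z.inf z.sup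

lemma mk_inf_sup {n : ℕ} (z : Sym2 (Fin n)) : s(z.inf, z.sup) = z := by
  induction z with
  | _ a b =>
    rcases le_total a b with h | h
    · simp [h]
    · simp [h, Sym2.eq_swap]

lemma mt_apply {n : ℕ} (S : Sy n) (i j) : mt S i j = S s(i, j) := rfl
lemma mt_transpose {n : ℕ} (S : Sy n) : (mt S)ᵀ = mt S := by
  ext i j; simp [mt_apply, Sym2.eq_swap]
lemma sy_mt {n : ℕ} (S : Sy n) : sy (mt S) = S := by
  funext z; simp only [sy, mt_apply, mk_inf_sup]
lemma mt_sy {n : ℕ} (A : Mx n) (hA : Aᵀ = A) : mt (sy A) = A := by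
  ext i j
  simp only [mt_apply, sy, Sym2.inf_mk, Sym2.sup_mk]
  rcases le_total i j with h | h
  · simp [h]
  · simp only [inf_of_le_right h, sup_of_le_left h]
    conv_rhs => rw [← hA]
    rfl
lemma sy_add {n : ℕ} (A B : Mx n) : sy (A + B) = sy A + sy B := rfl
lemma sy_smul {n : ℕ} (c : ℝ) (B : Mx n) : sy (c • B) = c • sy B := rfl
lemma mt_add {n : ℕ} (A B : Sy n) : mt (A + B) = mt A + mt B := rfl
lemma mt_smul {n : ℕ} (c : ℝ) (B : Sy n) : mt (c • B) = c • mt B := rfl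

lemma conj_symm {n : ℕ} (g A : Mx n) (hA : Aᵀ = A) : (g * A * gᵀ)ᵀ = g * A * gᵀ := by
  rw [transpose_mul, transpose_mul, transpose_transpose, hA, Matrix.mul_assoc]

def TH (n : ℕ) : Mx n →* Module.End ℝ (Sy n) where
  toFun g :=
    { toFun := fun S => sy (g * mt S * gᵀ)
      map_add' := fun M N => by rw [mt_add, Matrix.mul_add, Matrix.add_mul, sy_add]
      map_smul' := fun c M => by rw [mt_smul, Matrix.mul_smul, Matrix.smul_mul, sy_smul]; rfl }
  map_one' := by
    apply LinearMap.ext; intro S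
    simp [sy_mt]
  map_mul' g h := by
    apply LinearMap.ext; intro S
    show sy ((g * h) * mt S * (g * h)ᵀ) = sy (g * mt (sy (h * mt S * hᵀ)) * gᵀ)
    rw [mt_sy _ (conj_symm _ _ (mt_transpose S)), transpose_mul]
    simp only [Matrix.mul_assoc]

lemma TH_apply {n : ℕ} (g : Mx n) (S : Sy n) : TH n g S = sy (g * mt S * gᵀ) := rfl

lemma prod_sym2 {n : ℕ} (f : Fin n → Fin n → ℝ) :
    ∏ z : Sym2 (Fin n), f z.inf z.sup = ∏ i, ∏ j ∈ Finset.Ici i, f i j := by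
  rw [Finset.prod_sigma']
  refine Finset.prod_bij' (fun z _ => ⟨z.inf, z.sup⟩) (fun p _ => s(p.1, p.2)) ?_ ?_ ?_ ?_ ?_
  · intro z _; simp [Sym2.inf_le_sup]
  · intro p _; simp
  · intro z _; exact mk_inf_sup z
  · rintro ⟨i, j⟩ h
    have h : i ≤ j := by simpa using h
    simp [h]
  · intro z _; rfl

lemma det_TH (n : ℕ) (g : Mx n) : LinearMap.det (TH n g) = g.det ^ (n + 1) := by
  refine char_eq ((LinearMap.det : (Sy n →ₗ[ℝ] Sy n) →* ℝ).comp (TH n)) (n + 1) (fun d => ?_) g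
  show LinearMap.det (TH n (diagonal d)) = _
  have : TH n (diagonal d) = LinearMap.pi
      (fun z => ((d z.inf * d z.sup) • (LinearMap.id : ℝ →ₗ[ℝ] ℝ)).comp (LinearMap.proj z)) := by
    apply LinearMap.ext; intro S; funext z
    show (diagonal d * mt S * (diagonal d)ᵀ) z.inf z.sup = d z.inf * d z.sup * S z
    rw [diagonal_transpose, mul_diagonal, diagonal_mul, mt_apply, mk_inf_sup]; ring
  rw [this, LinearMap.det_pi]
  simp only [LinearMap.det_smul, Module.finrank_self, pow_one, LinearMap.det_id, mul_one]
  rw [prod_sym2 (fun i j => d i * d j)]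
  simp only [Finset.prod_mul_distrib]
  have h2 : ∏ i, ∏ j ∈ Finset.Ici i, d j = ∏ j, ∏ i ∈ Finset.Iic j, d j := by
    refine Finset.prod_comm' ?_
    intro x y; simp
  rw [h2, ← Finset.prod_mul_distrib, ← Finset.prod_pow]
  refine Finset.prod_congr rfl fun i _ => ?_
  rw [Finset.prod_const, Finset.prod_const, ← pow_add, Fin.card_Ici, Fin.card_Iic]
  congr 1
  omega

lemma lint_T {n : ℕ} (g : Mx n) (hg : g.det ≠ 0) (F : Sy n → ENNReal) (hF : Measurable F) :
    ∫⁻ S, F S = ENNReal.ofReal (|g.det| ^ (n + 1)) * ∫⁻ S, F (TH n g S) := by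
  have := lint_lin volume (TH n g) (by rw [det_TH]; exact pow_ne_zero _ hg) F hF
  rwa [det_TH, abs_pow] at this

noncomputable def Lq (n : ℕ) : V1 n ≃ₗ[ℝ] W1 n where
  toFun p := (fun z => if z.inf < z.sup then p.1 z.inf z.sup else p.2 z.inf,
    fun z => p.1 z.inf z.sup + p.1 z.sup z.inf)
  map_add' p q := by
    ext z
    · simp only [Prod.fst_add, Prod.snd_add, Pi.add_apply]; split_ifs <;> rfl
    · simp only [Prod.fst_add, Prod.snd_add, Pi.add_apply]; ring
  map_smul' c p := by
    ext z
    · simp only [Prod.smul_fst, Prod.smul_snd, Pi.smul_apply, RingHom.id_apply]; split_ifs <;> rfl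
    · simp only [Prod.smul_fst, Prod.smul_snd, Pi.smul_apply, RingHom.id_apply, smul_eq_mul]; ring
  invFun q := (fun i j => if i < j then q.1 s(i, j) else if i = j then q.2 s(i, i) / 2 else
      q.2 s(i, j) - q.1 s(i, j), fun i => q.1 s(i, i))
  left_inv p := by
    ext i j
    · rcases lt_trichotomy i j with h | h | h
      · simp [h, h.le]
      · subst h; simp
      · simp [h, h.le, h.not_gt, h.ne']
    · simp
  right_inv q := by
    ext z
    · induction z with
      | _ a b =>
        rcases lt_trichotomy a b with h | h | h
        · simp [h, h.le]
        · subst h; simp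
        · simp [h, h.le, Sym2.eq_swap]
    · induction z with
      | _ a b =>
        rcases lt_trichotomy a b with h | h | h
        · simp [h, h.le, h.not_gt, h.ne', Sym2.eq_swap]
        · subst h; simp
        · simp [h, h.le, h.not_gt, h.ne']
          rw [Sym2.eq_swap]; ring

def Psi {n : ℕ} (p : V1 n) : W1 n :=
  (sy (of p.1 * diagonal p.2 * (of p.1)ᵀ), sy (of p.1 * (of p.1)ᵀ))

def DPsi {n : ℕ} (p : V1 n) : V1 n →ₗ[ℝ] W1 n where
  toFun v := (sy (of v.1 * diagonal p.2 * (of p.1)ᵀ + of p.1 * diagonal p.2 * (of v.1)ᵀ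
      + of p.1 * diagonal v.2 * (of p.1)ᵀ), sy (of v.1 * (of p.1)ᵀ + of p.1 * (of v.1)ᵀ))
  map_add' v w := by
    have hd : diagonal (v.2 + w.2) = diagonal v.2 + diagonal w.2 := (diagonal_add _ _).symm
    simp only [Prod.fst_add, Prod.snd_add, ← of_add_of, Matrix.mul_add, Matrix.add_mul, hd,
      transpose_add, sy_add, Prod.mk_add_mk]
    congr 1 <;> abel
  map_smul' c v := by
    have hd : diagonal (c • v.2) = c • diagonal v.2 := diagonal_smul _ _
    simp only [Prod.smul_fst, Prod.smul_snd, ← smul_of, Matrix.mul_smul, Matrix.smul_mul, hd,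
      transpose_smul, sy_add, sy_smul, RingHom.id_apply, Prod.smul_mk, smul_add]

lemma hasFDerivAt_Psi {n : ℕ} (p : V1 n) : HasFDerivAt Psi (LinearMap.toContinuousLinearMap (DPsi p)) p := by
  have hX : ∀ i j, HasFDerivAt (fun p : V1 n => p.1 i j)
      ((ContinuousLinearMap.proj (R := ℝ) (φ := fun _ : Fin n => ℝ) j).comp ((ContinuousLinearMap.proj (R := ℝ) (φ := fun _ : Fin n => Fin n → ℝ) i).comp
        (ContinuousLinearMap.fst ℝ (E n n) (Fin n → ℝ)))) p := fun i j =>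
    ((ContinuousLinearMap.proj (R := ℝ) (φ := fun _ : Fin n => ℝ) j).comp ((ContinuousLinearMap.proj (R := ℝ) (φ := fun _ : Fin n => Fin n → ℝ) i).comp
        (ContinuousLinearMap.fst ℝ (E n n) (Fin n → ℝ)))).hasFDerivAt
  have hY : ∀ i, HasFDerivAt (fun p : V1 n => p.2 i)
      ((ContinuousLinearMap.proj (R := ℝ) (φ := fun _ : Fin n => ℝ) i).comp
        (ContinuousLinearMap.snd ℝ (E n n) (Fin n → ℝ))) p := fun i =>
    ((ContinuousLinearMap.proj (R := ℝ) (φ := fun _ : Fin n => ℝ) i).comp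
        (ContinuousLinearMap.snd ℝ (E n n) (Fin n → ℝ))).hasFDerivAt
  have e1 : ∀ i j (p : V1 n), (of p.1 * diagonal p.2 * (of p.1)ᵀ) i j = ∑ k, p.1 i k * p.2 k * p.1 j k := by
    intro i j p
    rw [mul_apply]; simp [mul_diagonal]
  have e2 : ∀ i j (p : V1 n), (of p.1 * (of p.1)ᵀ) i j = ∑ k, p.1 i k * p.1 j k := by
    intro i j p
    rw [mul_apply]; simp
  have hA : ∀ z, HasFDerivAt (fun p : V1 n => (Psi p).1 z) ((ContinuousLinearMap.proj (R := ℝ) (φ := fun _ : Sym2 (Fin n) => ℝ) z).comp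
     ((ContinuousLinearMap.fst ℝ _ _).comp (LinearMap.toContinuousLinearMap (DPsi p)))) p := by
    intro z
    simp only [Psi, sy, e1]
    refine (HasFDerivAt.fun_sum fun k _ => ((hX z.inf k).mul (hY k)).mul (hX z.sup k)).congr_fderiv ?_
    apply ContinuousLinearMap.ext
    intro v
    have : (DPsi p v).1 z = ∑ k, (v.1 z.inf k * p.2 k * p.1 z.sup k + p.1 z.inf k * p.2 k * v.1 z.sup k
       + p.1 z.inf k * v.2 k * p.1 z.sup k) := by
      simp only [DPsi, LinearMap.coe_mk, AddHom.coe_mk, sy, Matrix.add_apply, mul_apply]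
      simp [diagonal_apply, Finset.sum_add_distrib]
    show _ = (DPsi p v).1 z
    rw [this, ContinuousLinearMap.sum_apply]
    refine Finset.sum_congr rfl fun k _ => ?_
    simp
    ring
  have hB : ∀ z, HasFDerivAt (fun p : V1 n => (Psi p).2 z) ((ContinuousLinearMap.proj (R := ℝ) (φ := fun _ : Sym2 (Fin n) => ℝ) z).comp
     ((ContinuousLinearMap.snd ℝ _ _).comp (LinearMap.toContinuousLinearMap (DPsi p)))) p := by
    intro z
    simp only [Psi, sy, e2]
    refine (HasFDerivAt.fun_sum fun k _ => (hX z.inf k).mul (hX z.sup k)).congr_fderiv ?_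
    apply ContinuousLinearMap.ext
    intro v
    have : (DPsi p v).2 z = ∑ k, (v.1 z.inf k * p.1 z.sup k + p.1 z.inf k * v.1 z.sup k) := by
      simp only [DPsi, LinearMap.coe_mk, AddHom.coe_mk, sy, Matrix.add_apply, mul_apply]
      simp [Finset.sum_add_distrib]
    show _ = (DPsi p v).2 z
    rw [this, ContinuousLinearMap.sum_apply]
    refine Finset.sum_congr rfl fun k _ => ?_
    simp
    ring
  exact HasFDerivAt.prodMk (hasFDerivAt_pi.2 hA) (hasFDerivAt_pi.2 hB)

lemma det_shear {V : Type*} [AddCommGroup V] [Module ℝ V] [FiniteDimensional ℝ V]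
    (K : V →ₗ[ℝ] V) : LinearMap.det ((LinearMap.fst ℝ V V + K.comp (LinearMap.snd ℝ V V)).prod
      (LinearMap.snd ℝ V V)) = 1 := by
  set sh : (V →ₗ[ℝ] V) → (V × V →ₗ[ℝ] V × V) := fun K =>
    (LinearMap.fst ℝ V V + K.comp (LinearMap.snd ℝ V V)).prod (LinearMap.snd ℝ V V) with hsh
  have hadd : ∀ K K', sh K * sh K' = sh (K + K') := by
    intro K K'
    apply LinearMap.ext; rintro ⟨a, b⟩
    refine Prod.ext ?_ rfl
    show (a + K' b) + K b = a + (K b + K' b)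
    abel
  have h0 : sh 0 = 1 := by
    apply LinearMap.ext; rintro ⟨a, b⟩
    simp [hsh]
  let D : V × V →ₗ[ℝ] V × V := LinearMap.prodMap ((2 : ℝ) • LinearMap.id) LinearMap.id
  have hD : LinearMap.det D ≠ 0 := by
    simp [D, LinearMap.det_prodMap, LinearMap.det_smul]
  have hc : D * sh K = (sh K * sh K) * D := by
    rw [hadd]
    apply LinearMap.ext; rintro ⟨a, b⟩
    simp [hsh, D, two_smul]
    abel
  have h1 := congrArg LinearMap.det hc
  rw [map_mul, map_mul, map_mul, mul_comm] at h1
  have h2 := mul_right_cancel₀ hD h1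
  have h3 : LinearMap.det (sh K) ≠ 0 := by
    intro h
    have := congrArg LinearMap.det (hadd K (-K))
    rw [map_mul, h, add_neg_cancel, h0] at this
    simp at this
  have h4 : LinearMap.det (sh K) * 1 = LinearMap.det (sh K) * LinearMap.det (sh K) := by
    rw [mul_one]; exact h2
  exact (mul_left_cancel₀ h3 h4).symm

noncomputable def cz {n : ℕ} (l : Fin n → ℝ) (z : Sym2 (Fin n)) : ℝ :=
  if z.inf < z.sup then l z.sup - l z.inf else 1

noncomputable def dgl {n : ℕ} (c : Sym2 (Fin n) → ℝ) : Sy n →ₗ[ℝ] Sy n :=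
  LinearMap.pi (fun z => (c z • (LinearMap.id : ℝ →ₗ[ℝ] ℝ)).comp (LinearMap.proj z))

lemma det_dgl {n : ℕ} (c : Sym2 (Fin n) → ℝ) : LinearMap.det (dgl c) = ∏ z, c z := by
  rw [dgl, LinearMap.det_pi]
  simp [LinearMap.det_smul]

noncomputable def Bl {n : ℕ} (l : Fin n → ℝ) : W1 n →ₗ[ℝ] W1 n :=
  ((LinearMap.fst ℝ (Sy n) (Sy n) + (dgl fun z => l z.inf).comp (LinearMap.snd ℝ (Sy n) (Sy n))).prod
      (LinearMap.snd ℝ (Sy n) (Sy n))) * LinearMap.prodMap (dgl (cz l)) LinearMap.id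

lemma det_Bl {n : ℕ} (l : Fin n → ℝ) : LinearMap.det (Bl l) = ∏ z, cz l z := by
  rw [Bl, map_mul, det_shear, LinearMap.det_prodMap, det_dgl]; simp

noncomputable def Vd {n : ℕ} (l : Fin n → ℝ) : ℝ := ∏ i, ∏ j ∈ Finset.Ioi i, (l i - l j)

lemma prod_cz {n : ℕ} (l : Fin n → ℝ) : |∏ z, cz l z| = |Vd l| := by
  have := prod_sym2 (fun i j => if i < j then l j - l i else 1)
  rw [show (∏ z, cz l z) = _ from this, Vd, Finset.abs_prod, Finset.abs_prod]
  refine Finset.prod_congr rfl fun i _ => ?_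
  rw [Finset.abs_prod, Finset.abs_prod]
  rw [← Finset.Ioi_insert, Finset.prod_insert (by simp)]
  simp only [lt_irrefl, if_false, abs_one, one_mul]
  refine Finset.prod_congr rfl fun j hj => ?_
  rw [if_pos (Finset.mem_Ioi.1 hj), abs_sub_comm]

lemma DPsi_eq {n : ℕ} (p : V1 n) : DPsi p ∘ₗ (LinearMap.prodMap (leftHom n n (of p.1)) LinearMap.id) =
    (LinearMap.prodMap (TH n (of p.1)) (TH n (of p.1))) ∘ₗ (Bl p.2) ∘ₗ (Lq n).toLinearMap := by
  obtain ⟨g, l⟩ := p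
  apply LinearMap.ext; rintro ⟨w, d⟩
  have hB : Bl l (Lq n (w, d)) = (sy (of w * diagonal l + diagonal l * (of w)ᵀ + diagonal d),
      sy (of w + (of w)ᵀ)) := by
    ext z
    · show (if z.inf < z.sup then l z.sup - l z.inf else 1) * (if z.inf < z.sup then w z.inf z.sup else d z.inf)
        + l z.inf * (w z.inf z.sup + w z.sup z.inf) = (of w * diagonal l + diagonal l * (of w)ᵀ + diagonal d) z.inf z.sup
      rw [Matrix.add_apply, Matrix.add_apply, mul_diagonal, diagonal_mul, diagonal_apply, transpose_apply]
      simp only [of_apply]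
      rcases z.inf_le_sup.lt_or_eq with h | h
      · rw [if_pos h, if_pos h, if_neg h.ne]; ring
      · rw [if_neg h.not_lt, if_neg h.not_lt, if_pos h, ← h]; ring
    · rfl
  show DPsi (g, l) (leftHom n n (of g) w, d) = (TH n (of g) (Bl l (Lq n (w, d))).1, TH n (of g) (Bl l (Lq n (w, d))).2)
  rw [hB]
  have hl : of (leftHom n n (of g) w) = of g * of w := rfl
  simp only [TH_apply, DPsi, LinearMap.coe_mk, AddHom.coe_mk, hl]
  rw [mt_sy, mt_sy]
  · simp only [transpose_mul, Matrix.mul_add, Matrix.add_mul, Matrix.mul_assoc]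
  · rw [transpose_add, transpose_transpose, add_comm]
  · rw [transpose_add, transpose_add, transpose_mul, transpose_mul, transpose_transpose,
      diagonal_transpose, diagonal_transpose, add_comm (diagonal l * _)]

noncomputable def DPt {n : ℕ} (p : V1 n) : V1 n →L[ℝ] V1 n :=
  LinearMap.toContinuousLinearMap ((Lq n).symm.toLinearMap ∘ₗ DPsi p)

noncomputable def Pt {n : ℕ} (p : V1 n) : V1 n := (Lq n).symm (Psi p)

lemma hasFDerivAt_Pt {n : ℕ} (p : V1 n) : HasFDerivAt Pt (DPt p) p := by
  have := ((LinearMap.toContinuousLinearMap ((Lq n).symm.toLinearMap)).hasFDerivAt (x := Psi p)).comp p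
    (hasFDerivAt_Psi p)
  exact this

lemma abs_det_DPt {n : ℕ} (p : V1 n) (hp : dt p.1 ≠ 0) :
    |(DPt p).det| = |dt p.1| ^ (n + 2) * |Vd p.2| := by
  have h1 : (DPt p).det = LinearMap.det ((Lq n).symm.toLinearMap ∘ₗ DPsi p) := rfl
  have h2 : ((Lq n).symm.toLinearMap ∘ₗ DPsi p) ∘ₗ
      (LinearMap.prodMap (leftHom n n (of p.1)) LinearMap.id) =
      (Lq n).symm.toLinearMap ∘ₗ ((LinearMap.prodMap (TH n (of p.1)) (TH n (of p.1))) ∘ₗ (Bl p.2)) ∘ₗ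
        (Lq n).symm.symm.toLinearMap := by
    rw [LinearMap.comp_assoc, DPsi_eq]; rfl
  have h3 := congrArg LinearMap.det h2
  rw [LinearMap.det_conj, LinearMap.det_comp, LinearMap.det_comp, LinearMap.det_prodMap,
    LinearMap.det_prodMap, det_leftHom, det_TH, det_Bl, LinearMap.det_id, ← h1, mul_one] at h3
  have h4 := congrArg abs h3
  rw [abs_mul, abs_mul, prod_cz, abs_mul, abs_pow, abs_pow] at h4
  have h5 : (0:ℝ) < |dt p.1| := abs_pos.2 hp
  have h6 : |(of p.1).det| = |dt p.1| := rfl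
  rw [h6] at h4
  refine mul_right_cancel₀ (pow_pos h5 n).ne' (h4.trans ?_)
  ring

end SVF


namespace SVF
open Matrix

def sgn (b : Bool) : ℝ := if b then 1 else -1
lemma sgn_sq (b : Bool) : sgn b * sgn b = 1 := by cases b <;> simp [sgn]

def Ge {n : ℕ} (i0 : Fin n) (ε : Fin n → Bool) : Set (E n n) :=
  {g | dt g ≠ 0 ∧ ∀ j, 0 < sgn (ε j) * g i0 j}
def Cs (n : ℕ) : Set (Fin n → ℝ) := {l | StrictAnti l}
def PDs (n : ℕ) : Set (Sy n) := {P | ∀ i, 0 < ev (mt P) i}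

lemma measurable_evmt (n : ℕ) : Measurable (fun P : Sy n => ev (mt P)) :=
  measurable_dets_comp _ fun _ _ => measurable_pi_apply _

lemma measurableSet_PDs (n : ℕ) : MeasurableSet (PDs n) := by
  have : PDs n = ⋂ i, {P | 0 < ev (mt P) i} := by ext; simp [PDs]
  rw [this]
  exact MeasurableSet.iInter fun i => measurableSet_lt measurable_const
    ((measurable_pi_apply i).comp (measurable_evmt n))

lemma measurableSet_Ge {n : ℕ} (i0 : Fin n) (ε : Fin n → Bool) : MeasurableSet (Ge i0 ε) := by
  have : Ge i0 ε = {g | dt g ≠ 0} ∩ ⋂ j, {g | 0 < sgn (ε j) * g i0 j} := by ext; simp [Ge]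
  rw [this]
  refine MeasurableSet.inter ((continuous_dt n).measurable (measurableSet_singleton 0).compl) ?_
  refine MeasurableSet.iInter fun j => measurableSet_lt measurable_const ?_
  fun_prop

lemma measurableSet_Cs (n : ℕ) : MeasurableSet (Cs n) := by
  have : Cs n = ⋂ i, ⋂ j, ⋂ (_ : i < j), {l | l j < l i} := by
    ext l; simp only [Cs, StrictAnti, Set.mem_iInter]; rfl
  rw [this]
  refine MeasurableSet.iInter fun i => MeasurableSet.iInter fun j => MeasurableSet.iInter fun _ => ?_
  exact measurableSet_lt (measurable_pi_apply _) (measurable_pi_apply _)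

lemma Psi_inj {n : ℕ} (i0 : Fin n) (ε : Fin n → Bool) : Set.InjOn (Psi (n := n)) (Ge i0 ε ×ˢ Cs n) := by
  rintro ⟨g, l⟩ ⟨⟨hg, hgs⟩, hl⟩ ⟨g', l'⟩ ⟨⟨hg', hgs'⟩, hl'⟩ h
  have hl : StrictAnti l := hl
  have hl' : StrictAnti l' := hl'
  have h1 : of g * diagonal l * (of g)ᵀ = of g' * diagonal l' * (of g')ᵀ := by
    have := congrArg (fun q => mt q.1) h
    simp only [Psi] at this
    rwa [mt_sy _ (conj_symm _ _ (diagonal_transpose _)), mt_sy _ (conj_symm _ _ (diagonal_transpose _))] at this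
  have h2 : of g * (of g)ᵀ = of g' * (of g')ᵀ := by
    have := congrArg (fun q => mt q.2) h
    simp only [Psi] at this
    rwa [mt_sy _ (by simp), mt_sy _ (by simp)] at this
  have hu : IsUnit (of g).det := isUnit_iff_ne_zero.2 hg
  have hut : IsUnit (of g)ᵀ.det := by rw [det_transpose]; exact hu
  set K : Mx n := (of g)⁻¹ * of g' with hK
  have hgK : of g * K = of g' := by rw [hK, mul_nonsing_inv_cancel_left _ _ hu]
  have hKK : K * Kᵀ = 1 := by
    have : of g * 1 * (of g)ᵀ = of g * (K * Kᵀ) * (of g)ᵀ := by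
      rw [Matrix.mul_one, h2, ← hgK, transpose_mul]; simp only [Matrix.mul_assoc]
    have h3 := congrArg (fun A => (of g)⁻¹ * A * (of g)ᵀ⁻¹) this
    simp only [Matrix.mul_assoc, nonsing_inv_mul_cancel_left _ _ hu, mul_nonsing_inv _ hut] at h3
    simpa using h3.symm
  have hD : diagonal l = K * diagonal l' * Kᵀ := by
    have : of g * diagonal l * (of g)ᵀ = of g * (K * diagonal l' * Kᵀ) * (of g)ᵀ := by
      rw [h1, ← hgK, transpose_mul]; simp only [Matrix.mul_assoc]
    have h3 := congrArg (fun A => (of g)⁻¹ * A * (of g)ᵀ⁻¹) this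
    simp only [Matrix.mul_assoc, nonsing_inv_mul_cancel_left _ _ hu, mul_nonsing_inv _ hut] at h3
    simpa [Matrix.mul_assoc] using h3
  have hKK' : Kᵀ * K = 1 := mul_eq_one_comm.1 hKK
  have hDK : diagonal l * K = K * diagonal l' := by
    rw [hD, Matrix.mul_assoc, hKK', Matrix.mul_one]
  have hll : l = l' := by
    refine evl_injOn n hl.antitone hl'.antitone ?_
    rw [← dets_diagonal, ← dets_diagonal]
    exact dets_similar _ _ K (det_ne_zero_of_orth hKK) hDK
  subst hll
  have hoff : ∀ i j, i ≠ j → K i j = 0 := by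
    intro i j hij
    have := congrFun (congrFun hDK i) j
    rw [diagonal_mul, mul_diagonal] at this
    have h5 : (l i - l j) * K i j = 0 := by linear_combination this
    rcases mul_eq_zero.1 h5 with h6 | h6
    · exact absurd (hl.injective (sub_eq_zero.1 h6)) hij
    · exact h6
  have hKd : K = diagonal (fun i => K i i) := by
    ext i j
    by_cases hij : i = j
    · subst hij; simp
    · rw [hoff i j hij, diagonal_apply_ne _ hij]
  have hsq : ∀ i, K i i * K i i = 1 := by
    intro i
    have := congrFun (congrFun hKK i) i
    rw [hKd, diagonal_transpose, diagonal_mul_diagonal, diagonal_apply_eq, one_apply_eq] at this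
    exact this
  have hone : ∀ j, K j j = 1 := by
    intro j
    have h6 : g' i0 j = g i0 j * K j j := by
      have := congrFun (congrFun hgK i0) j
      rw [hKd, mul_diagonal] at this
      exact this.symm
    have h7 : 0 < sgn (ε j) * g' i0 j := hgs' j
    have h9 : 0 < sgn (ε j) * g i0 j := hgs j
    rw [h6, ← mul_assoc] at h7
    have h8 : 0 < K j j := (mul_pos_iff_of_pos_left h9).1 h7
    nlinarith [hsq j]
  have : K = 1 := by
    rw [hKd]; simp only [hone]; exact diagonal_one
  rw [this, Matrix.mul_one] at hgK
  exact Prod.ext hgK rfl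

lemma Psi_surj {n : ℕ} (q : W1 n) (hq : q.2 ∈ PDs n) : ∃ p : V1 n, dt p.1 ≠ 0 ∧ Antitone p.2 ∧ Psi p = q := by
  obtain ⟨S, P⟩ := q
  obtain ⟨r, hr, hP⟩ := exists_root (mt P) ⟨mt_transpose P, hq⟩
  have hu : IsUnit r.det := isUnit_iff_ne_zero.2 hr
  have hut : IsUnit rᵀ.det := by rw [det_transpose]; exact hu
  set A : Mx n := r⁻¹ * mt S * (r⁻¹)ᵀ with hA
  have hAs : Aᵀ = A := conj_symm _ _ (mt_transpose S)
  obtain ⟨U, h1, h2, h3, h4⟩ := ev_spec A hAs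
  have hS : mt S = r * A * rᵀ := by
    rw [hA, transpose_nonsing_inv]
    simp only [Matrix.mul_assoc, nonsing_inv_mul _ hut, Matrix.mul_one,
      mul_nonsing_inv_cancel_left _ _ hu]
  refine ⟨(of.symm (r * U), ev A), ?_, h3, ?_⟩
  · show (r * U).det ≠ 0
    rw [det_mul]
    exact mul_ne_zero hr (det_ne_zero_of_orth h1)
  · refine Prod.ext ?_ ?_
    · show sy ((r * U) * diagonal (ev A) * (r * U)ᵀ) = S
      rw [← sy_mt S, hS]
      conv_rhs => rw [h4]
      rw [transpose_mul]; simp only [Matrix.mul_assoc]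
    · show sy ((r * U) * (r * U)ᵀ) = P
      rw [← sy_mt P, hP, transpose_mul]
      congr 1
      calc r * U * (Uᵀ * rᵀ) = r * (U * Uᵀ) * rᵀ := by simp only [Matrix.mul_assoc]
        _ = _ := by rw [h1, Matrix.mul_one]

lemma Psi_mem {n : ℕ} (p : V1 n) (hp : dt p.1 ≠ 0) : (Psi p).2 ∈ PDs n := by
  have h : (of p.1 * (of p.1)ᵀ).det ≠ 0 := by
    rw [det_mul, det_transpose]; exact mul_ne_zero hp hp
  have := (PDm_mul_transpose _ h).2
  intro i
  show 0 < ev (mt (sy (of p.1 * (of p.1)ᵀ))) i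
  rw [mt_sy _ (by simp)]
  exact this i

lemma flip_sign {n : ℕ} (i0 : Fin n) (ε : Fin n → Bool) (p : V1 n) (hp : dt p.1 ≠ 0)
    (h0 : ∀ j, p.1 i0 j ≠ 0) : ∃ g ∈ Ge i0 ε, Psi (g, p.2) = Psi p := by
  have : ∀ j, ∃ d : ℝ, d * d = 1 ∧ 0 < sgn (ε j) * (p.1 i0 j * d) := by
    intro j
    have h1 : sgn (ε j) * p.1 i0 j ≠ 0 := by
      refine mul_ne_zero (fun h => ?_) (h0 j)
      have := sgn_sq (ε j); rw [h] at this; simp at this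
    rcases lt_or_gt_of_ne h1 with h | h
    · exact ⟨-1, by norm_num, by nlinarith⟩
    · exact ⟨1, by norm_num, by nlinarith⟩
  choose d hd1 hd2 using this
  have hdd : diagonal d * diagonal d = (1 : Mx n) := by
    rw [diagonal_mul_diagonal, ← diagonal_one]; congr 1; funext j; exact hd1 j
  refine ⟨of.symm (of p.1 * diagonal d), ⟨?_, ?_⟩, ?_⟩
  · show (of p.1 * diagonal d).det ≠ 0
    rw [det_mul]
    refine mul_ne_zero hp fun h => ?_
    have := congrArg det hdd
    rw [det_mul, h] at this; simp at this
  · intro j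
    have : of.symm (of p.1 * diagonal d) i0 j = p.1 i0 j * d j := by
      rw [of_symm_apply, mul_diagonal]; rfl
    rw [this]; exact hd2 j
  · have e1 : (of p.1 * diagonal d) * diagonal p.2 * (of p.1 * diagonal d)ᵀ =
        of p.1 * diagonal p.2 * (of p.1)ᵀ := by
      rw [transpose_mul, diagonal_transpose]
      have : diagonal d * diagonal p.2 * diagonal d = diagonal p.2 := by
        rw [diagonal_mul_diagonal, diagonal_mul_diagonal]; congr 1; funext j
        rw [mul_right_comm, hd1, one_mul]
      calc _ = of p.1 * (diagonal d * diagonal p.2 * diagonal d) * (of p.1)ᵀ := by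
            simp only [Matrix.mul_assoc]
        _ = _ := by rw [this]
    have e2 : (of p.1 * diagonal d) * (of p.1 * diagonal d)ᵀ = of p.1 * (of p.1)ᵀ := by
      rw [transpose_mul, diagonal_transpose]
      calc _ = of p.1 * (diagonal d * diagonal d) * (of p.1)ᵀ := by
            simp only [Matrix.mul_assoc]
        _ = _ := by rw [hdd, Matrix.mul_one]
    show (sy ((of p.1 * diagonal d) * diagonal p.2 * (of p.1 * diagonal d)ᵀ),
      sy ((of p.1 * diagonal d) * (of p.1 * diagonal d)ᵀ)) = _
    rw [e1, e2]; rfl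

lemma strictAnti_of_Vd {n : ℕ} {l : Fin n → ℝ} (h : Antitone l) (hV : Vd l ≠ 0) : StrictAnti l := by
  intro i j hij
  refine lt_of_le_of_ne (h hij.le) fun he => hV ?_
  exact Finset.prod_eq_zero (Finset.mem_univ i) (Finset.prod_eq_zero (Finset.mem_Ioi.2 hij) (by rw [he, sub_self]))

lemma null_lin {V : Type*} [NormedAddCommGroup V] [NormedSpace ℝ V] [FiniteDimensional ℝ V]
    [MeasurableSpace V] [BorelSpace V] (μ : Measure V) [μ.IsAddHaarMeasure] (f : V →ₗ[ℝ] ℝ)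
    (v : V) (hv : f v ≠ 0) : μ {x | f x = 0} = 0 := by
  have := Measure.addHaar_submodule μ (LinearMap.ker f) (fun h => hv (by
    have : v ∈ LinearMap.ker f := h ▸ Submodule.mem_top
    exact this))
  exact this

lemma null_row {n : ℕ} (i0 : Fin n) : ∀ᵐ g : E n n, ∀ j, g i0 j ≠ 0 := by
  rw [ae_all_iff]
  intro j
  have := null_lin (volume : Measure (E n n)) ((LinearMap.proj (R := ℝ) (φ := fun _ : Fin n => ℝ) j).comp
    (LinearMap.proj (R := ℝ) (φ := fun _ : Fin n => Fin n → ℝ) i0)) (fun _ _ => 1) (by simp)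
  rw [ae_iff]
  simpa using this

lemma null_eq (n : ℕ) : ∀ᵐ l : Fin n → ℝ, ∀ i j, i ≠ j → l i ≠ l j := by
  rw [ae_all_iff]; intro i
  rw [ae_all_iff]; intro j
  by_cases hij : i = j
  · simp [hij]
  have := null_lin (volume : Measure (Fin n → ℝ)) ((LinearMap.proj (R := ℝ) (φ := fun _ : Fin n => ℝ) i) -
    (LinearMap.proj (R := ℝ) (φ := fun _ : Fin n => ℝ) j)) (Pi.single i 1) (by simp [hij])
  rw [ae_iff]
  simpa [hij, sub_eq_zero] using this

lemma null_dt' (n : ℕ) : ∀ᵐ g : E n n, dt g ≠ 0 := by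
  filter_upwards [null_dt n n le_rfl] with g hg h
  apply hg; rw [dt_gram, h]; simp

lemma Cs_ae (n : ℕ) : (Cs n : Set (Fin n → ℝ)) =ᵐ[volume] Ch n := by
  filter_upwards [null_eq n] with l hl
  refine propext ⟨fun h => StrictAnti.antitone h, fun h => ?_⟩
  intro i j hij
  exact lt_of_le_of_ne (h hij.le) (fun he => hl i j hij.ne he.symm)

end SVF


namespace SVF
open Matrix

instance haarE (n m : ℕ) : (volume : Measure (E n m)).IsAddHaarMeasure := 
  Measure.pi.isAddHaarMeasure (fun _ : Fin n => (volume : Measure (Fin m → ℝ)))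
instance haarV1 (n : ℕ) : (volume : Measure (V1 n)).IsAddHaarMeasure :=
  Measure.prod.instIsAddHaarMeasure (volume : Measure (E n n))  (volume : Measure (Fin n → ℝ))
instance haarW1 (n : ℕ) : (volume : Measure (W1 n)).IsAddHaarMeasure :=
  Measure.prod.instIsAddHaarMeasure (volume : Measure (Sy n)) (volume : Measure (Sy n))

/-- target set in `V1` -/
def Tt (n : ℕ) : Set (V1 n) := {v | (Lq n v).2 ∈ PDs n}

lemma Pt_ae {n : ℕ} (i0 : Fin n) (ε : Fin n → Bool) :
    (Pt '' (Ge i0 ε ×ˢ Cs n) : Set (V1 n)) =ᵐ[volume] Tt n := by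
  have hd : ∀ p : V1 n, Lq n (Pt p) = Psi p := fun p => by simp [Pt]
  have hsub : Pt '' (Ge i0 ε ×ˢ Cs n) ⊆ Tt n := by
    rintro _ ⟨p, ⟨⟨hp, -⟩, -⟩, rfl⟩
    show (Lq n (Pt p)).2 ∈ PDs n
    rw [hd]; exact Psi_mem p hp
  let N1 : Set (V1 n) := {p | dt p.1 ≠ 0 ∧ Vd p.2 = 0}
  let N2 : Set (V1 n) := {p | ¬ ∀ j, p.1 i0 j ≠ 0}
  have hN1 : volume (Pt '' N1) = 0 := by
    refine addHaar_image_eq_zero_of_det_fderivWithin_eq_zero volume (f' := DPt)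
      (fun p _ => (hasFDerivAt_Pt p).hasFDerivWithinAt) ?_
    rintro p ⟨h1, h2⟩
    rw [← abs_eq_zero, abs_det_DPt p h1, h2]; simp
  have hN2' : volume N2 = 0 := by
    have : ∀ᵐ p : V1 n, ∀ j, p.1 i0 j ≠ 0 :=
      (Measure.quasiMeasurePreserving_fst (μ := (volume : Measure (E n n)))
        (ν := (volume : Measure (Fin n → ℝ)))).ae (null_row i0)
    exact ae_iff.1 this
  have hN2 : volume (Pt '' N2) = 0 := by
    refine addHaar_image_eq_zero_of_differentiableOn_of_addHaar_eq_zero volume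
      (fun p _ => (hasFDerivAt_Pt p).differentiableAt.differentiableWithinAt) hN2'
  have hcov : Tt n ⊆ Pt '' (Ge i0 ε ×ˢ Cs n) ∪ (Pt '' N1 ∪ Pt '' N2) := by
    intro v hv
    obtain ⟨p, h1, h2, h3⟩ := Psi_surj (Lq n v) hv
    have h4 : Pt p = v := by rw [Pt, h3]; simp
    by_cases hV : Vd p.2 = 0
    · exact Or.inr (Or.inl ⟨p, ⟨h1, hV⟩, h4⟩)
    by_cases h0 : ∀ j, p.1 i0 j ≠ 0
    · obtain ⟨g, hg, hgp⟩ := flip_sign i0 ε p h1 h0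
      refine Or.inl ⟨(g, p.2), ⟨hg, strictAnti_of_Vd h2 hV⟩, ?_⟩
      rw [Pt, hgp]; exact h4
    · exact Or.inr (Or.inr ⟨p, h0, h4⟩)
  refine hsub.eventuallyLE.antisymm ?_
  have hnull : ∀ᵐ v : V1 n, v ∉ Pt '' N1 ∪ Pt '' N2 :=
    measure_eq_zero_iff_ae_notMem.1 (measure_union_null hN1 hN2)
  filter_upwards [hnull] with v hv hT
  exact (hcov hT).resolve_right hv

lemma int_Ge {n : ℕ} (i0 : Fin n) (ε : Fin n → Bool) (F : V1 n → ENNReal) :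
    ∫⁻ v in Tt n, F v = ∫⁻ p in Ge i0 ε ×ˢ Cs n, ENNReal.ofReal (|dt p.1| ^ (n + 2) * |Vd p.2|) * F (Pt p) := by
  have hm : MeasurableSet (Ge i0 ε ×ˢ Cs n) := (measurableSet_Ge i0 ε).prod (measurableSet_Cs n)
  rw [← setLIntegral_congr (Pt_ae i0 ε)]
  rw [lintegral_image_eq_lintegral_abs_det_fderiv_mul volume hm
    (fun p _ => (hasFDerivAt_Pt p).hasFDerivWithinAt)]
  · refine setLIntegral_congr_fun hm fun p hp => ?_
    rw [abs_det_DPt p hp.1.1]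
  · intro p hp q hq h
    exact Psi_inj i0 ε hp hq ((Lq n).symm.injective h)

lemma iUnion_Ge_ae {n : ℕ} (i0 : Fin n) : (⋃ ε, Ge i0 ε ×ˢ Cs n : Set (V1 n)) =ᵐ[volume] (Set.univ ×ˢ Ch n : Set (V1 n)) := by
  have h1 : ∀ᵐ p : V1 n, (∀ j, p.1 i0 j ≠ 0) ∧ dt p.1 ≠ 0 :=
    (Measure.quasiMeasurePreserving_fst (μ := (volume : Measure (E n n)))
      (ν := (volume : Measure (Fin n → ℝ)))).ae ((null_row i0).and (null_dt' n))
  have h2 : ∀ᵐ p : V1 n, (p.2 ∈ Cs n) = (p.2 ∈ Ch n) :=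
    (Measure.quasiMeasurePreserving_snd (μ := (volume : Measure (E n n)))
      (ν := (volume : Measure (Fin n → ℝ)))).ae (Cs_ae n)
  filter_upwards [h1, h2] with p hp hp2
  show (p ∈ ⋃ ε, Ge i0 ε ×ˢ Cs n) = (p ∈ (Set.univ ×ˢ Ch n : Set (V1 n)))
  simp only [Set.mem_iUnion, Set.mem_prod, Set.mem_univ, true_and, exists_and_right, hp2]
  refine propext ⟨fun h => h.2, fun h => ⟨?_, h⟩⟩
  refine ⟨fun j => decide (0 < p.1 i0 j), hp.2, fun j => ?_⟩
  rcases lt_or_gt_of_ne (hp.1 j) with h | h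
  · simp [sgn, h.not_gt, h]
  · simp [sgn, h]

lemma Ge_disj {n : ℕ} (i0 : Fin n) : Pairwise (Function.onFun Disjoint fun ε => (Ge i0 ε ×ˢ Cs n : Set (V1 n))) := by
  intro ε ε' hne
  rw [Function.onFun, Set.disjoint_left]
  rintro p ⟨⟨-, h⟩, -⟩ ⟨⟨-, h'⟩, -⟩
  apply hne
  funext j
  have h1 := h j; have h2 := h' j
  cases h3 : ε j <;> cases h4 : ε' j <;> simp [h3, h4, sgn] at h1 h2 ⊢ <;> linarith

lemma int_all {n : ℕ} (i0 : Fin n) (F : V1 n → ENNReal) :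
    2 ^ n * ∫⁻ v in Tt n, F v =
      ∫⁻ p in Set.univ ×ˢ Ch n, ENNReal.ofReal (|dt p.1| ^ (n + 2) * |Vd p.2|) * F (Pt p) := by
  rw [← setLIntegral_congr (iUnion_Ge_ae i0), lintegral_iUnion
    (fun ε => (measurableSet_Ge i0 ε).prod (measurableSet_Cs n)) (Ge_disj i0), tsum_fintype]
  simp only [← int_Ge i0]
  simp

lemma chg (n : ℕ) (i0 : Fin n) : ∃ c : ENNReal, c ≠ 0 ∧ c ≠ ⊤ ∧ ∀ F : W1 n → ENNReal, Measurable F →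
    c * ∫⁻ q in Prod.snd ⁻¹' PDs n, F q =
      ∫⁻ p in Set.univ ×ˢ Ch n, ENNReal.ofReal (|dt p.1| ^ (n + 2) * |Vd p.2|) * F (Psi p) := by
  let L := (Lq n).toContinuousLinearEquiv
  have hL : Measurable L := L.continuous.measurable
  let μ : Measure (W1 n) := Measure.map L volume
  have : μ.IsAddHaarMeasure := L.isAddHaarMeasure_map volume
  set k := μ.addHaarScalarFactor volume with hk
  have hμ : μ = k • volume := Measure.isAddLeftInvariant_eq_smul μ volume
  have hk0 : k ≠ 0 := (Measure.addHaarScalarFactor_pos_of_isAddHaarMeasure μ volume).ne'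
  refine ⟨2 ^ n * k, ?_, ?_, fun F hF => ?_⟩
  · simp [hk0]
  · exact ENNReal.mul_ne_top (by simp) (by simp)
  have h := int_all i0 (fun v => F (Lq n v))
  have hd : ∀ p : V1 n, Lq n (Pt p) = Psi p := fun p => by simp [Pt]
  simp only [hd] at h
  rw [← h, mul_assoc]
  congr 1
  have hms : MeasurableSet (Prod.snd ⁻¹' PDs n : Set (W1 n)) := measurable_snd (measurableSet_PDs n)
  have h2 : ∫⁻ q in Prod.snd ⁻¹' PDs n, F q ∂μ = ∫⁻ v in Tt n, F (Lq n v) :=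
    setLIntegral_map hms hF hL
  rw [← h2, hμ, Measure.restrict_smul, lintegral_smul_measure]
  rfl

end SVF


namespace SVF
open Matrix

lemma ev_conj {n : ℕ} (g A : Mx n) (hg : g.det ≠ 0) : ev ((g * gᵀ)⁻¹ * (g * A * gᵀ)) = ev A := by
  have hu : IsUnit g.det := isUnit_iff_ne_zero.2 hg
  have hut : IsUnit gᵀ.det := by rw [det_transpose]; exact hu
  refine ev_similar _ _ (gᵀ)⁻¹ ?_ ?_
  · rw [det_nonsing_inv, det_transpose]
    simpa using hg
  · rw [Matrix.mul_inv_rev]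
    simp only [Matrix.mul_assoc, mul_nonsing_inv _ hut, Matrix.mul_one, nonsing_inv_mul_cancel_left _ _ hu]

noncomputable def sd {n : ℕ} (P : Sy n) : ℝ := Real.sqrt (mt P).det

lemma continuous_sd (n : ℕ) : Continuous (sd (n := n)) := by
  refine Real.continuous_sqrt.comp ?_
  have : Continuous fun P : Sy n => (fun i j => P s(i, j) : E n n) := by fun_prop
  exact (continuous_dt n).comp this

lemma sd_root {n : ℕ} (P : Sy n) (r : Mx n) (h : mt P = r * rᵀ) : sd P = |r.det| := by
  rw [sd, h, det_mul, det_transpose, Real.sqrt_mul_self_eq_abs]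

lemma sd_gram {n : ℕ} (g : E n n) : sd (sy (of g * (of g)ᵀ)) = |dt g| :=
  sd_root _ _ (mt_sy _ (by simp))

lemma continuous_sygram (n : ℕ) : Continuous fun g : E n n => sy (of g * (of g)ᵀ) := by
  refine continuous_pi fun z => ?_
  simp only [sy, mul_apply, transpose_apply, of_apply]
  fun_prop

lemma measurable_evPS (n : ℕ) : Measurable fun q : W1 n => ev ((mt q.2)⁻¹ * mt q.1) := by
  refine measurable_dets_comp _ fun i j => ?_
  simp only [mul_apply]
  refine Finset.measurable_sum _ fun k _ => ?_
  have h1 : Measurable fun q : W1 n => (fun i j => q.2 s(i, j) : E n n) := by fun_prop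
  have h2 := (measurable_inv' n).comp h1
  have h3 : Measurable fun q : W1 n => (mt q.2)⁻¹ i k :=
    (measurable_pi_apply k).comp ((measurable_pi_apply i).comp h2)
  have h4 : Measurable fun q : W1 n => mt q.1 k j := by
    simp only [mt_apply]; fun_prop
  exact h3.mul h4

lemma measurable_evS {n : ℕ} (P : Sy n) : Measurable fun S : Sy n => ev ((mt P)⁻¹ * mt S) := by
  generalize (mt P)⁻¹ = A
  refine measurable_dets_comp _ fun i j => ?_
  simp only [mul_apply, mt_apply]
  fun_prop

lemma continuous_Vd (n : ℕ) : Continuous (Vd (n := n)) := by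
  unfold Vd; fun_prop

theorem Bp (n : ℕ) (i0 : Fin n) : ∃ c : ENNReal, c ≠ 0 ∧ c ≠ ⊤ ∧
    ∀ (f : (Fin n → ℝ) → ENNReal) (F : Sy n → ENNReal), Measurable f → Measurable F →
    c * ((∫⁻ S : Sy n, f (ev (mt S))) * ∫⁻ P in PDs n, F P * ENNReal.ofReal (sd P ^ (n + 1))) =
      (∫⁻ g : E n n, F (sy (of g * (of g)ᵀ)) * ENNReal.ofReal (|dt g| ^ (n + 2))) *
        ∫⁻ l in Ch n, f l * ENNReal.ofReal |Vd l| := by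
  obtain ⟨c, hc0, hct, hc⟩ := chg n i0
  refine ⟨c, hc0, hct, fun f F hf hF => ?_⟩
  have hG : Measurable fun q : W1 n => f (ev ((mt q.2)⁻¹ * mt q.1)) * F q.2 :=
    (hf.comp (measurable_evPS n)).mul (hF.comp measurable_snd)
  have h := hc _ hG
  have hL : ∫⁻ q in Prod.snd ⁻¹' PDs n, f (ev ((mt q.2)⁻¹ * mt q.1)) * F q.2 =
      (∫⁻ S : Sy n, f (ev (mt S))) * ∫⁻ P in PDs n, F P * ENNReal.ofReal (sd P ^ (n + 1)) := by
    have e : (volume : Measure (W1 n)).restrict (Prod.snd ⁻¹' PDs n) =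
        (volume : Measure (Sy n)).prod ((volume : Measure (Sy n)).restrict (PDs n)) := by
      rw [← Set.univ_prod, Measure.volume_eq_prod, ← Measure.prod_restrict, Measure.restrict_univ]
    rw [e, lintegral_prod_symm _ hG.aemeasurable, ← lintegral_const_mul _ (by
      exact hF.mul ((continuous_sd n).measurable.pow_const _).ennreal_ofReal)]
    refine setLIntegral_congr_fun (measurableSet_PDs n) fun P hP => ?_
    obtain ⟨r, hr, hrP⟩ := exists_root (mt P) ⟨mt_transpose P, hP⟩
    have m1 : Measurable fun S : Sy n => f (ev ((mt P)⁻¹ * mt S)) :=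
      hf.comp (measurable_evS P)
    show ∫⁻ S, f (ev ((mt P)⁻¹ * mt S)) * F P = _
    rw [lintegral_mul_const _ m1, lint_T r hr _ m1, ← sd_root P r hrP]
    have : ∀ S : Sy n, ev ((mt P)⁻¹ * mt (TH n r S)) = ev (mt S) := fun S => by
      rw [TH_apply, mt_sy _ (conj_symm _ _ (mt_transpose S)), hrP, ev_conj _ _ hr]
    simp only [this]
    ring
  have hR : ∫⁻ p in Set.univ ×ˢ Ch n, ENNReal.ofReal (|dt p.1| ^ (n + 2) * |Vd p.2|) *
       (f (ev ((mt (Psi p).2)⁻¹ * mt (Psi p).1)) * F (Psi p).2) =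
      (∫⁻ g : E n n, F (sy (of g * (of g)ᵀ)) * ENNReal.ofReal (|dt g| ^ (n + 2))) *
        ∫⁻ l in Ch n, f l * ENNReal.ofReal |Vd l| := by
    have e : (volume : Measure (V1 n)).restrict (Set.univ ×ˢ Ch n) =
        (volume : Measure (E n n)).prod ((volume : Measure (Fin n → ℝ)).restrict (Ch n)) := by
      rw [Measure.volume_eq_prod, ← Measure.prod_restrict, Measure.restrict_univ]
    have m1 : Measurable fun g : E n n => F (sy (of g * (of g)ᵀ)) * ENNReal.ofReal (|dt g| ^ (n + 2)) :=
      (hF.comp (continuous_sygram n).measurable).mul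
        (((continuous_dt n).abs.pow _).measurable.ennreal_ofReal)
    have m2 : Measurable fun l : Fin n → ℝ => f l * ENNReal.ofReal |Vd l| :=
      hf.mul ((continuous_Vd n).abs.measurable.ennreal_ofReal)
    rw [← lintegral_prod_mul m1.aemeasurable m2.aemeasurable, ← e]
    have a1 : ∀ᵐ p : V1 n, dt p.1 ≠ 0 :=
      (Measure.quasiMeasurePreserving_fst (μ := (volume : Measure (E n n)))
        (ν := (volume : Measure (Fin n → ℝ)))).ae (null_dt' n)
    refine lintegral_congr_ae ?_
    filter_upwards [ae_restrict_of_ae a1, ae_restrict_mem (MeasurableSet.univ.prod (isClosed_Ch n).measurableSet)] with p hp hp2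
    have hs : (mt (Psi p).2)⁻¹ * mt (Psi p).1 =
       (of p.1 * (of p.1)ᵀ)⁻¹ * (of p.1 * diagonal p.2 * (of p.1)ᵀ) := by
      simp only [Psi]
      rw [mt_sy _ (conj_symm _ _ (diagonal_transpose _)), mt_sy _ (by simp)]
    have hev : ev (diagonal p.2) = p.2 := by
      rw [ev, dets_diagonal, qf_evl hp2.2]
    rw [hs, ev_conj _ _ hp, hev, ENNReal.ofReal_mul (by positivity)]
    simp only [Psi]
    ring
  rw [hL, hR] at h
  exact h

lemma fin_lint {X : Type*} [TopologicalSpace X] [T2Space X] [MeasurableSpace X] [OpensMeasurableSpace X] (μ : Measure X)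
    [IsFiniteMeasureOnCompacts μ] {K : Set X} (hK : IsCompact K) {f : X → ℝ} (hf : Continuous f) :
    ∫⁻ x in K, ENNReal.ofReal (f x) ∂μ ≠ ⊤ :=
  (hf.continuousOn.integrableOn_compact hK).lintegral_lt_top.ne

lemma pos_lint {X : Type*} [TopologicalSpace X] [MeasurableSpace X] (μ : Measure X)
    [μ.IsOpenPosMeasure] {O : Set X} (hO : IsOpen O) (hne : O.Nonempty) {f : X → ENNReal} (hf : Measurable f)
    (h : ∀ x ∈ O, f x ≠ 0) : ∫⁻ x, f x ∂μ ≠ 0 := by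
  intro h0
  rw [lintegral_eq_zero_iff hf] at h0
  have h1 : μ O = 0 := by
    refine measure_mono_null (fun x hx => ?_) (ae_iff.1 h0)
    exact h x hx
  exact (hO.measure_pos μ hne).ne' h1

end SVF


namespace SVF
open Matrix

noncomputable def wt (n k : ℕ) (s : ℝ) : ENNReal :=
  ENNReal.ofReal (s ^ k) * (ENNReal.ofReal (s ^ (n + 2)))⁻¹ * ENNReal.ofReal (s ^ (n + 1))

def Pos (n : ℕ) : Set (Fin n → ℝ) := {l | ∀ i, 0 < l i}

lemma isOpen_Pos (n : ℕ) : IsOpen (Pos n) := by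
  have : Pos n = ⋂ i, {l | 0 < l i} := by ext; simp [Pos]
  rw [this]
  exact isOpen_iInter_of_finite fun i => isOpen_lt continuous_const (continuous_apply i)

lemma isOpen_Cs (n : ℕ) : IsOpen (Cs n) := by
  have : Cs n = ⋂ i, ⋂ j, ⋂ (_ : i < j), {l | l j < l i} := by
    ext l; simp only [Cs, StrictAnti, Set.mem_iInter]; rfl
  rw [this]
  refine isOpen_iInter_of_finite fun i => isOpen_iInter_of_finite fun j => isOpen_iInter_of_finite fun _ => ?_
  exact isOpen_lt (continuous_apply _) (continuous_apply _)

lemma measurable_wt (n k : ℕ) : Measurable (wt n k) := by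
  unfold wt
  exact ((measurable_id.pow_const _).ennreal_ofReal.mul
    ((measurable_id.pow_const _).ennreal_ofReal.inv)).mul (measurable_id.pow_const _).ennreal_ofReal

noncomputable def f2 {n : ℕ} (k : ℕ) (f : (Fin n → ℝ) → ENNReal) : (Fin n → ℝ) → ENNReal :=
  (Pos n).indicator fun l => f l * wt n k (Real.sqrt (∏ i, l i))

lemma measurable_f2 {n : ℕ} (k : ℕ) (f : (Fin n → ℝ) → ENNReal) (hf : Measurable f) :
    Measurable (f2 k f) := by
  refine Measurable.indicator (hf.mul ((measurable_wt n k).comp ?_)) (isOpen_Pos n).measurableSet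
  have : Continuous fun l : Fin n → ℝ => Real.sqrt (∏ i, l i) := by fun_prop
  exact this.measurable

lemma Vd_ne {n : ℕ} {l : Fin n → ℝ} (h : StrictAnti l) : Vd l ≠ 0 := by
  refine Finset.prod_ne_zero_iff.2 fun i _ => Finset.prod_ne_zero_iff.2 fun j hj => ?_
  exact (sub_pos.2 (h (Finset.mem_Ioi.1 hj))).ne'

theorem assembly (n m : ℕ) (i0 : Fin n) (hnm : n ≤ m) : ∃ A B : ENNReal, A ≠ 0 ∧ A ≠ ⊤ ∧
    ∀ f : (Fin n → ℝ) → ENNReal, Measurable f →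
      A * ∫⁻ M : E n m, f (ev (of M * (of M)ᵀ)) =
        B * ∫⁻ l in Ch n, f2 (m - n) f l * ENNReal.ofReal |Vd l| := by
  obtain ⟨c, hc0, hct, hB⟩ := Bp n i0
  obtain ⟨c1, hA⟩ := partA n m hnm
  let f0 : (Fin n → ℝ) → ENNReal := (Metric.closedBall 0 (n + 1 : ℝ)).indicator 1
  let F0 : Sy n → ENNReal := (Metric.closedBall 0 (2 : ℝ)).indicator 1
  have hf0 : Measurable f0 := measurable_one.indicator Metric.isClosed_closedBall.measurableSet
  have hF0 : Measurable F0 := measurable_one.indicator Metric.isClosed_closedBall.measurableSet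
  set c0 := ∫⁻ S : Sy n, f0 (ev (mt S)) with hc0'
  set v0 := ∫⁻ l in Ch n, f0 l * ENNReal.ofReal |Vd l| with hv0
  set d0 := ∫⁻ P in PDs n, F0 P * ENNReal.ofReal (sd P ^ (n + 1)) with hd0
  set e0 := ∫⁻ g : E n n, F0 (sy (of g * (of g)ᵀ)) * ENNReal.ofReal (|dt g| ^ (n + 2)) with he0
  have hcd : c * (c0 * d0) = e0 * v0 := hB f0 F0 hf0 hF0
  have v0t : v0 ≠ ⊤ := by
    refine ne_top_of_le_ne_top (fin_lint (volume : Measure (Fin n → ℝ))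
      (isCompact_closedBall 0 (n + 1 : ℝ)) (continuous_Vd n).abs) ?_
    rw [← lintegral_indicator Metric.isClosed_closedBall.measurableSet]
    refine (setLIntegral_le_lintegral _ _).trans (lintegral_mono fun l => ?_)
    by_cases hl : l ∈ Metric.closedBall (0 : Fin n → ℝ) (n + 1 : ℝ)
    · simp only [f0, Set.indicator_of_mem hl, Pi.one_apply, one_mul]; exact le_rfl
    · simp only [f0, Set.indicator_of_notMem hl, zero_mul]; exact le_rfl
  have v00 : v0 ≠ 0 := by
    rw [hv0, ← lintegral_indicator (isClosed_Ch n).measurableSet]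
    refine pos_lint volume (O := Cs n ∩ Metric.ball 0 (n + 1 : ℝ)) ((isOpen_Cs n).inter Metric.isOpen_ball) ?_ ?_ ?_
    · refine ⟨fun i => (n : ℝ) - i, ?_, ?_⟩
      · intro i j hij
        have : ((i : ℕ) : ℝ) < ((j : ℕ) : ℝ) := by exact_mod_cast hij
        simp only; linarith
      · rw [mem_ball_zero_iff, pi_norm_lt_iff (by positivity)]
        intro i
        have h1 : ((i : ℕ) : ℝ) < n := by exact_mod_cast i.2
        have h2 : (0 : ℝ) ≤ ((i : ℕ) : ℝ) := by positivity
        rw [Real.norm_eq_abs, abs_lt]; constructor <;> linarith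
    · exact (hf0.mul (continuous_Vd n).abs.measurable.ennreal_ofReal).indicator (isClosed_Ch n).measurableSet
    · rintro l ⟨h1, h2⟩
      rw [Set.indicator_of_mem (show l ∈ Ch n from StrictAnti.antitone h1)]
      have h3 : f0 l = 1 := Set.indicator_of_mem (Metric.ball_subset_closedBall h2) _
      rw [h3, one_mul]
      exact (ENNReal.ofReal_pos.2 (abs_pos.2 (Vd_ne h1))).ne'
  have e00 : e0 ≠ 0 := by
    have hop : IsOpen {g : E n n | dt g ≠ 0} := isOpen_ne.preimage (continuous_dt n)
    refine pos_lint volume (O := {g : E n n | dt g ≠ 0} ∩ (fun g => sy (of g * (of g)ᵀ)) ⁻¹' Metric.ball 0 2)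
      (hop.inter (Metric.isOpen_ball.preimage (continuous_sygram n))) ?_ ?_ ?_
    · refine ⟨of.symm 1, ?_, ?_⟩
      · show (1 : Mx n).det ≠ 0
        simp
      · show sy ((1 : Mx n) * (1 : Mx n)ᵀ) ∈ Metric.ball 0 2
        rw [mem_ball_zero_iff, pi_norm_lt_iff (by positivity)]
        intro z
        rw [transpose_one, Matrix.mul_one, sy, one_apply]
        split_ifs <;> norm_num
    · exact (hF0.comp (continuous_sygram n).measurable).mul
        (((continuous_dt n).abs.pow _).measurable.ennreal_ofReal)
    · rintro g ⟨h1, h2⟩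
      have h1 : dt g ≠ 0 := h1
      have h3 : F0 (sy (of g * (of g)ᵀ)) = 1 := Set.indicator_of_mem (Metric.ball_subset_closedBall h2) _
      rw [h3, one_mul]
      exact (ENNReal.ofReal_pos.2 (pow_pos (abs_pos.2 h1) _)).ne'
  have d00 : d0 ≠ 0 := by
    intro h
    rw [h, mul_zero, mul_zero] at hcd
    exact mul_ne_zero e00 v00 hcd.symm
  have d0t : d0 ≠ ⊤ := by
    refine ne_top_of_le_ne_top (fin_lint (volume : Measure (Sy n))
      (isCompact_closedBall 0 (2 : ℝ)) ((continuous_sd n).pow (n + 1))) ?_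
    rw [← lintegral_indicator Metric.isClosed_closedBall.measurableSet]
    refine (setLIntegral_le_lintegral _ _).trans (lintegral_mono fun l => ?_)
    by_cases hl : l ∈ Metric.closedBall (0 : Sy n) (2 : ℝ)
    · simp only [F0, Set.indicator_of_mem hl, Pi.one_apply, one_mul]; exact le_rfl
    · simp only [F0, Set.indicator_of_notMem hl, zero_mul]; exact le_rfl
  refine ⟨ch n * v0 * d0, c1 * c0 * e0, mul_ne_zero (mul_ne_zero (ch_ne_zero n) v00) d00,
    ENNReal.mul_ne_top (ENNReal.mul_ne_top (ch_ne_top n) v0t) d0t, fun f hf => ?_⟩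
  set k := m - n
  have hfe : Measurable fun S : E n n => f (ev (of S)) :=
    hf.comp (measurable_dets_comp _ fun i j => (measurable_pi_apply j).comp (measurable_pi_apply i))
  have hA' : ch n * ∫⁻ M : E n m, f (ev (of M * (of M)ᵀ)) =
      c1 * ∫⁻ g : E n n, f (ev (of g * (of g)ᵀ)) * ENNReal.ofReal (|dt g| ^ k) := hA _ hfe
  set J := ∫⁻ P in PDs n, f (ev (mt P)) * wt n k (sd P) with hJ
  have mF : Measurable fun P : Sy n => f (ev (mt P)) *
      (ENNReal.ofReal (sd P ^ k) * (ENNReal.ofReal (sd P ^ (n + 2)))⁻¹) :=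
    (hf.comp (measurable_evmt n)).mul ((((continuous_sd n).pow k).measurable.ennreal_ofReal).mul
      (((continuous_sd n).pow (n + 2)).measurable.ennreal_ofReal.inv))
  have h1 := hB f0 _ hf0 mF
  have h2 := hB (f2 k f) F0 (measurable_f2 k f hf) hF0
  have e1 : ∫⁻ P in PDs n, f (ev (mt P)) *
      (ENNReal.ofReal (sd P ^ k) * (ENNReal.ofReal (sd P ^ (n + 2)))⁻¹) * ENNReal.ofReal (sd P ^ (n + 1)) = J := by
    simp only [hJ, wt, mul_assoc]
  have e2 : ∫⁻ g : E n n, f (ev (mt (sy (of g * (of g)ᵀ)))) *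
      (ENNReal.ofReal (sd (sy (of g * (of g)ᵀ)) ^ k) * (ENNReal.ofReal (sd (sy (of g * (of g)ᵀ)) ^ (n + 2)))⁻¹)
        * ENNReal.ofReal (|dt g| ^ (n + 2)) =
      ∫⁻ g : E n n, f (ev (of g * (of g)ᵀ)) * ENNReal.ofReal (|dt g| ^ k) := by
    refine lintegral_congr_ae ?_
    filter_upwards [null_dt' n] with g hg
    rw [sd_gram, mt_sy _ (by simp), mul_assoc, mul_assoc, ENNReal.inv_mul_cancel, mul_one]
    · exact (ENNReal.ofReal_pos.2 (pow_pos (abs_pos.2 hg) _)).ne'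
    · exact ENNReal.ofReal_ne_top
  have e3 : ∫⁻ S : Sy n, f2 k f (ev (mt S)) = J := by
    rw [hJ, ← lintegral_indicator (measurableSet_PDs n)]
    refine lintegral_congr fun S => ?_
    by_cases hS : S ∈ PDs n
    · have hS' : ev (mt S) ∈ Pos n := hS
      rw [f2, Set.indicator_of_mem hS, Set.indicator_of_mem hS', sd, det_eq_prod_ev _ (mt_transpose S)]
    · have hS' : ev (mt S) ∉ Pos n := hS
      rw [f2, Set.indicator_of_notMem hS, Set.indicator_of_notMem hS']
  rw [e1, e2] at h1
  rw [e3] at h2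
  calc ch n * v0 * d0 * ∫⁻ M : E n m, f (ev (of M * (of M)ᵀ))
      = v0 * d0 * (ch n * ∫⁻ M : E n m, f (ev (of M * (of M)ᵀ))) := by ring
    _ = c1 * d0 * ((∫⁻ g : E n n, f (ev (of g * (of g)ᵀ)) * ENNReal.ofReal (|dt g| ^ k)) * v0) := by
        rw [hA']; ring
    _ = c1 * c0 * (c * (J * d0)) := by rw [← h1]; ring
    _ = _ := by rw [h2]; ring

end SVF


namespace SVF
open Matrix

def sqm {n : ℕ} (x : Fin n → ℝ) : Fin n → ℝ := fun i => x i ^ 2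

noncomputable def Dsq {n : ℕ} (x : Fin n → ℝ) : (Fin n → ℝ) →L[ℝ] (Fin n → ℝ) :=
  LinearMap.toContinuousLinearMap
    (LinearMap.pi fun i => ((2 * x i) • (LinearMap.id : ℝ →ₗ[ℝ] ℝ)).comp (LinearMap.proj i))

lemma det_Dsq {n : ℕ} (x : Fin n → ℝ) : (Dsq x).det = 2 ^ n * ∏ i, x i := by
  have : (Dsq x).det = LinearMap.det (LinearMap.pi fun i =>
    ((2 * x i) • (LinearMap.id : ℝ →ₗ[ℝ] ℝ)).comp (LinearMap.proj (φ := fun _ : Fin n => ℝ) i)) := rfl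
  rw [this, LinearMap.det_pi]
  simp [LinearMap.det_smul, Finset.prod_mul_distrib]

lemma hasFDerivAt_sqm {n : ℕ} (x : Fin n → ℝ) : HasFDerivAt sqm (Dsq x) x := by
  have h : ∀ i, HasFDerivAt (fun x : Fin n → ℝ => x i ^ 2)
      ((ContinuousLinearMap.proj (R := ℝ) (φ := fun _ : Fin n => ℝ) i).comp (Dsq x)) x := by
    intro i
    have h1 : HasFDerivAt (fun x : Fin n → ℝ => x i) (ContinuousLinearMap.proj (R := ℝ) (φ := fun _ : Fin n => ℝ) i) x :=
      (ContinuousLinearMap.proj (R := ℝ) (φ := fun _ : Fin n => ℝ) i).hasFDerivAt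
    refine (h1.pow 2).congr_fderiv ?_
    apply ContinuousLinearMap.ext; intro v
    show _ = (2 * x i) * v i
    simp
  exact hasFDerivAt_pi.2 h

lemma sqm_image (n : ℕ) : sqm '' (Ch n ∩ Pos n) = Ch n ∩ Pos n := by
  ext l; constructor
  · rintro ⟨x, ⟨h1, h2⟩, rfl⟩
    refine ⟨fun i j hij => ?_, fun i => pow_pos (h2 i) 2⟩
    exact pow_le_pow_left₀ (h2 j).le (h1 hij) 2
  · rintro ⟨h1, h2⟩
    refine ⟨fun i => Real.sqrt (l i), ⟨fun i j hij => Real.sqrt_le_sqrt (h1 hij), fun i => Real.sqrt_pos.2 (h2 i)⟩, ?_⟩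
    funext i; exact Real.sq_sqrt (h2 i).le

lemma sqm_inj (n : ℕ) : Set.InjOn (sqm (n := n)) (Ch n ∩ Pos n) := by
  rintro x ⟨-, hx⟩ y ⟨-, hy⟩ h
  funext i
  have : x i ^ 2 = y i ^ 2 := congrFun h i
  exact (pow_left_inj₀ (hx i).le (hy i).le two_ne_zero).1 this

def Chn (n : ℕ) : Set (Fin n → ℝ) := {x | (∀ i j, i ≤ j → x j ≤ x i) ∧ ∀ i, 0 ≤ x i}

lemma isClosed_Chn (n : ℕ) : IsClosed (Chn n) := by
  have : Chn n = Ch n ∩ ⋂ i, {x | 0 ≤ x i} := by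
    ext x; simp only [Chn, Set.mem_inter_iff, Set.mem_iInter]; rfl
  rw [this]
  exact (isClosed_Ch n).inter (isClosed_iInter fun i => isClosed_le continuous_const (continuous_apply i))

lemma Chn_ae (n : ℕ) : (Ch n ∩ Pos n : Set (Fin n → ℝ)) =ᵐ[volume] Chn n := by
  have : ∀ᵐ x : Fin n → ℝ, ∀ i, x i ≠ 0 := by
    rw [ae_all_iff]; intro i
    have := null_lin (volume : Measure (Fin n → ℝ)) (LinearMap.proj (R := ℝ) (φ := fun _ : Fin n => ℝ) i)
      (fun _ => 1) (by simp)
    rw [ae_iff]; simpa using this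
  filter_upwards [this] with x hx
  refine propext ⟨fun h => ⟨fun i j hij => h.1 hij, fun i => (h.2 i).le⟩, fun h => ⟨fun i j hij => h.1 i j hij, fun i => ?_⟩⟩
  exact lt_of_le_of_ne (h.2 i) (hx i).symm

lemma Vd_nonneg {n : ℕ} {l : Fin n → ℝ} (h : Antitone l) : 0 ≤ Vd l :=
  Finset.prod_nonneg fun _ _ => Finset.prod_nonneg fun _ hj => sub_nonneg.2 (h (Finset.mem_Ioi.1 hj).le)

lemma wt_eq (n k : ℕ) (s : ℝ) (hs : 0 < s) : ENNReal.ofReal (2 ^ n * s) * wt n k s =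
    ENNReal.ofReal (2 ^ n) * ENNReal.ofReal (s ^ k) := by
  rw [wt, ← ENNReal.ofReal_inv_of_pos (by positivity), ← ENNReal.ofReal_mul (by positivity),
    ← ENNReal.ofReal_mul (by positivity), ← ENNReal.ofReal_mul (by positivity),
    ← ENNReal.ofReal_mul (by positivity)]
  congr 1
  field_simp
  ring

lemma subst_sq {n : ℕ} (k : ℕ) (f : (Fin n → ℝ) → ENNReal) (hf : Measurable f) :
    ∫⁻ l in Ch n, f2 k f l * ENNReal.ofReal |Vd l| =
      ENNReal.ofReal (2 ^ n) * ∫⁻ x in Chn n, f (sqm x) * ENNReal.ofReal ((∏ i, x i ^ k) * Vd (sqm x)) := by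
  have mC := (isClosed_Ch n).measurableSet
  have mP := (isOpen_Pos n).measurableSet
  have e1 : ∫⁻ l in Ch n, f2 k f l * ENNReal.ofReal |Vd l| =
      ∫⁻ l in Ch n ∩ Pos n, f l * wt n k (Real.sqrt (∏ i, l i)) * ENNReal.ofReal |Vd l| := by
    rw [← lintegral_indicator mC, ← lintegral_indicator (mC.inter mP)]
    refine lintegral_congr fun l => ?_
    by_cases h1 : l ∈ Ch n <;> by_cases h2 : l ∈ Pos n <;> simp [f2, h1, h2]
  rw [e1]
  conv_lhs => rw [← sqm_image n]
  rw [lintegral_image_eq_lintegral_abs_det_fderiv_mul volume (mC.inter mP)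
    (fun x _ => (hasFDerivAt_sqm x).hasFDerivWithinAt) (sqm_inj n), ← setLIntegral_congr (Chn_ae n),
    ← lintegral_const_mul]
  · refine setLIntegral_congr_fun (mC.inter mP) fun x hx => ?_
    have hp : 0 < ∏ i, x i := Finset.prod_pos fun i _ => hx.2 i
    have hs : Real.sqrt (∏ i, sqm x i) = ∏ i, x i := by
      simp only [sqm, Finset.prod_pow]; exact Real.sqrt_sq hp.le
    have hV : 0 ≤ Vd (sqm x) := Vd_nonneg (sqm_image n ▸ Set.mem_image_of_mem sqm hx : sqm x ∈ Ch n ∩ Pos n).1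
    rw [det_Dsq, hs, abs_of_pos (by positivity), abs_of_nonneg hV]
    calc _ = (ENNReal.ofReal (2 ^ n * ∏ i, x i) * wt n k (∏ i, x i)) * f (sqm x) * ENNReal.ofReal (Vd (sqm x)) := by
          ring
      _ = _ := by
          rw [wt_eq _ _ _ hp, Finset.prod_pow, ENNReal.ofReal_mul (by positivity)]; ring
  · have c1 : Continuous (sqm (n := n)) := by unfold sqm; fun_prop
    refine (hf.comp c1.measurable).mul (Continuous.measurable ?_).ennreal_ofReal
    exact (by fun_prop : Continuous fun x : Fin n → ℝ => ∏ i, x i ^ k).mul ((continuous_Vd n).comp c1)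

lemma sum_ev {n m : ℕ} (M : E n m) : ∑ i, ev (of M * (of M)ᵀ) i = ∑ i, ∑ j, M i j ^ 2 := by
  obtain ⟨U, h1, h2, h3, h4⟩ := ev_spec (of M * (of M)ᵀ) (by simp)
  have h5 := congrArg trace h4
  rw [trace_mul_comm (U * _) Uᵀ, ← Matrix.mul_assoc, h2, Matrix.one_mul, trace_diagonal] at h5
  rw [← h5]
  simp [trace, mul_apply, sq]

theorem main1 (n m : ℕ) (i0 : Fin n) (hnm : n ≤ m) : ∃ C : ℝ, 0 < C ∧
    ∀ f : (Fin n → ℝ) → ENNReal, Measurable f →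
      ∫⁻ M : E n m, f (ev (of M * (of M)ᵀ)) = ENNReal.ofReal C *
        ∫⁻ x in Chn n, f (sqm x) * ENNReal.ofReal ((∏ i, x i ^ (m - n)) * Vd (sqm x)) := by
  obtain ⟨A, B, hA0, hAt, h⟩ := assembly n m i0 hnm
  set k := m - n
  let f0 : (Fin n → ℝ) → ENNReal := {l | ∑ i, l i ≤ 1}.indicator 1
  have hcl : IsClosed {l : Fin n → ℝ | ∑ i, l i ≤ 1} := isClosed_le (by fun_prop) continuous_const
  have hf0 : Measurable f0 := measurable_one.indicator hcl.measurableSet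
  have c1 : Continuous (sqm (n := n)) := by unfold sqm; fun_prop
  have cw : Continuous fun x : Fin n → ℝ => (∏ i, x i ^ k) * Vd (sqm x) :=
    (by fun_prop : Continuous fun x : Fin n → ℝ => ∏ i, x i ^ k).mul ((continuous_Vd n).comp c1)
  set I := ∫⁻ M : E n m, f0 (ev (of M * (of M)ᵀ)) with hI
  set R := ∫⁻ x in Chn n, f0 (sqm x) * ENNReal.ofReal ((∏ i, x i ^ k) * Vd (sqm x)) with hR
  have hIe : I = volume {M : E n m | ∑ i, ∑ j, M i j ^ 2 ≤ 1} := by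
    have hm : MeasurableSet {M : E n m | ∑ i, ∑ j, M i j ^ 2 ≤ 1} :=
      (isClosed_le (by fun_prop) continuous_const).measurableSet
    rw [hI, ← lintegral_indicator_one hm]
    refine lintegral_congr fun M => ?_
    simp only [f0, Set.indicator_apply, Set.mem_ofPred_eq, sum_ev]
    rfl
  have hIt : I ≠ ⊤ := by rw [hIe]; exact (volume_ball_finite 1).ne
  have hI0 : I ≠ 0 := by
    rw [hIe]
    have ho : IsOpen {M : E n m | ∑ i, ∑ j, M i j ^ 2 < 1} := isOpen_lt (by fun_prop) continuous_const
    have := ho.measure_pos volume ⟨0, by simp⟩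
    refine (this.trans_le (measure_mono fun M hM => ?_)).ne'
    have hM' : ∑ i, ∑ j, M i j ^ 2 < 1 := hM
    show ∑ i, ∑ j, M i j ^ 2 ≤ 1
    exact hM'.le
  have hRt : R ≠ ⊤ := by
    refine ne_top_of_le_ne_top (fin_lint (volume : Measure (Fin n → ℝ))
      (isCompact_closedBall 0 (1 : ℝ)) cw) ?_
    rw [← lintegral_indicator Metric.isClosed_closedBall.measurableSet]
    refine (setLIntegral_le_lintegral _ _).trans (lintegral_mono fun l => ?_)
    by_cases hl : l ∈ Metric.closedBall (0 : Fin n → ℝ) (1 : ℝ)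
    · simp only [Set.indicator_of_mem hl]
      refine mul_le_of_le_one_left (by simp) ?_
      exact Set.indicator_le_self' (by simp) _
    · have : sqm l ∉ {l : Fin n → ℝ | ∑ i, l i ≤ 1} := by
        intro h
        apply hl
        rw [mem_closedBall_zero_iff, pi_norm_le_iff_of_nonneg zero_le_one]
        intro i
        have h1 : l i ^ 2 ≤ ∑ i, l i ^ 2 :=
          Finset.single_le_sum (f := fun i => l i ^ 2) (fun i _ => sq_nonneg _) (Finset.mem_univ i)
        have h2 : ∑ i, l i ^ 2 ≤ 1 := h
        rw [Real.norm_eq_abs, ← abs_one, ← sq_le_sq, one_pow]; linarith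
      simp only [f0, Set.indicator_of_notMem this, zero_mul]; exact zero_le
  have hR0 : R ≠ 0 := by
    have hm := (isClosed_Chn n).measurableSet
    rw [hR, ← lintegral_indicator hm]
    have ho : IsOpen {x : Fin n → ℝ | ∑ i, x i ^ 2 < 1} := isOpen_lt (by fun_prop) continuous_const
    refine pos_lint volume (O := Cs n ∩ (Pos n ∩ {x | ∑ i, x i ^ 2 < 1}))
      ((isOpen_Cs n).inter ((isOpen_Pos n).inter ho)) ?_ ?_ ?_
    · have hn : 0 < n := i0.pos
      have hnr : (0 : ℝ) < n := by exact_mod_cast hn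
      refine ⟨fun i => ((n : ℝ) - i) / (2 * n ^ 2), ?_, ?_, ?_⟩
      · intro i j hij
        have : ((i : ℕ) : ℝ) < ((j : ℕ) : ℝ) := by exact_mod_cast hij
        simp only
        gcongr
      · intro i
        have h1 : ((i : ℕ) : ℝ) < n := by exact_mod_cast i.2
        have : 0 < (n : ℝ) - i := by linarith
        positivity
      · show ∑ i : Fin n, (((n : ℝ) - i) / (2 * n ^ 2)) ^ 2 < 1
        have hb : ∀ i : Fin n, (((n : ℝ) - i) / (2 * n ^ 2)) ^ 2 ≤ 1 / (4 * n ^ 2) := by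
          intro i
          have h1 : ((i : ℕ) : ℝ) < n := by exact_mod_cast i.2
          have h2 : (0 : ℝ) ≤ ((i : ℕ) : ℝ) := by positivity
          have h3 : ((n : ℝ) - i) ^ 2 ≤ n ^ 2 := by
            apply pow_le_pow_left₀ <;> linarith
          rw [div_pow, div_le_div_iff₀ (by positivity) (by positivity)]
          nlinarith [mul_le_mul_of_nonneg_right h3 (by positivity : (0:ℝ) ≤ 4 * n ^ 2)]
        refine (Finset.sum_le_sum fun i _ => hb i).trans_lt ?_
        rw [Finset.sum_const, Finset.card_univ, Fintype.card_fin, nsmul_eq_mul]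
        have h1n : (1 : ℝ) ≤ n := by exact_mod_cast hn
        rw [mul_one_div, div_lt_one (by positivity)]
        nlinarith
    · exact ((hf0.comp c1.measurable).mul cw.measurable.ennreal_ofReal).indicator hm
    · rintro x ⟨h1, h2, h3⟩
      have h1' : StrictAnti x := h1
      have hx : x ∈ Chn n := ⟨fun i j hij => h1'.antitone hij, fun i => (h2 i).le⟩
      have h3' : ∑ i, x i ^ 2 < 1 := h3
      have hmem : sqm x ∈ {l : Fin n → ℝ | ∑ i, l i ≤ 1} := by
        show ∑ i, x i ^ 2 ≤ 1
        exact h3'.le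
      have h4 : f0 (sqm x) = 1 := Set.indicator_of_mem hmem _
      rw [Set.indicator_of_mem hx, h4, one_mul]
      have h5 : StrictAnti (sqm x) := fun i j hij => pow_lt_pow_left₀ (h1' hij) (h2 j).le two_ne_zero
      have h6 : 0 < Vd (sqm x) := lt_of_le_of_ne (Vd_nonneg h5.antitone) (Vd_ne h5).symm
      have h7 : 0 < ∏ i, x i ^ k := Finset.prod_pos fun i _ => pow_pos (h2 i) k
      exact (ENNReal.ofReal_pos.2 (mul_pos h7 h6)).ne'
  have key : ∀ f : (Fin n → ℝ) → ENNReal, Measurable f →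
      A * ∫⁻ M : E n m, f (ev (of M * (of M)ᵀ)) = (B * ENNReal.ofReal (2 ^ n)) *
        ∫⁻ x in Chn n, f (sqm x) * ENNReal.ofReal ((∏ i, x i ^ k) * Vd (sqm x)) := by
    intro f hf
    rw [h f hf, subst_sq k f hf, mul_assoc]
  set D := B * ENNReal.ofReal (2 ^ n)
  have k0 : A * I = D * R := key f0 hf0
  have hD0 : D ≠ 0 := by
    intro h0
    rw [h0, zero_mul] at k0
    exact mul_ne_zero hA0 hI0 k0
  have hDt : D ≠ ⊤ := by
    intro h0
    rw [h0, ENNReal.top_mul hR0] at k0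
    exact ENNReal.mul_ne_top hAt hIt k0
  refine ⟨(A⁻¹ * D).toReal, ENNReal.toReal_pos (mul_ne_zero (ENNReal.inv_ne_zero.2 hAt) hD0)
    (ENNReal.mul_ne_top (ENNReal.inv_ne_top.2 hA0) hDt), fun f hf => ?_⟩
  rw [ENNReal.ofReal_toReal (ENNReal.mul_ne_top (ENNReal.inv_ne_top.2 hA0) hDt), mul_assoc, ← key f hf,
    ← mul_assoc, ENNReal.inv_mul_cancel hA0 hAt, one_mul]

end SVF

namespace SVF

open Matrix

lemma svDecr_eq {n m : ℕ} (M : Matrix (Fin n) (Fin m) ℝ) :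
    svDecr M = fun i => Real.sqrt (ev (M * Mᵀ) i) := by
  have hp := posSemidef_self_mul_conjTranspose M
  have hH := isHermitian_mul_conjTranspose_self M
  set e := (isHermitian_mul_conjTranspose_self M).eigenvalues with he
  have e0 : ∀ i, 0 ≤ e i := fun i => hp.eigenvalues_nonneg i
  set s := Tuple.sort (fun j => -(sv M j)) with hs
  have hsv : ∀ i, sv M i = Real.sqrt (e i) := fun i => rfl
  have hmono : Monotone ((fun j => -(sv M j)) ∘ s) := Tuple.monotone_sort _
  have hanti : Antitone (e ∘ s) := by
    intro i j hij
    have h1 := hmono hij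
    simp only [Function.comp, hsv, neg_le_neg_iff] at h1
    exact (Real.sqrt_le_sqrt_iff (e0 _)).1 h1
  have hd : dets (M * Mᵀ) = evl (e ∘ s) := by
    funext t
    have h2 := congrArg (Polynomial.eval (t : ℝ)) hH.charpoly_eq
    rw [eval_charpoly, Polynomial.eval_prod] at h2
    have h3 : evl (e ∘ s) t = ∏ i, ((t : ℝ) - e i) :=
      Equiv.prod_comp s (fun i => (t : ℝ) - e i)
    rw [h3, dets, smul_one_eq_diagonal]
    simp only [Polynomial.eval_sub, Polynomial.eval_X, Polynomial.eval_C, scalar_apply] at h2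
    rw [← conjTranspose_eq_transpose_of_trivial M]
    exact h2
  have hev : ev (M * Mᵀ) = e ∘ s := by rw [ev, hd, qf_evl hanti]
  rw [hev]
  rfl

end SVF

/-- for `n ≤ m` there is a constant `C_{n,m} > 0` such that for every
nonnegative measurable `φ : ℝⁿ → ℝ`,
`∫_{ℝ^{n×m}} φ(σ↓(M)) dM
  = C ⬝ ∫_{x₁ ≥ … ≥ xₙ ≥ 0} φ(x) ∏ xᵢ^{m-n} ∏_{i<j} (xᵢ² - xⱼ²) dx`
(both sides interpreted as Lebesgue integrals of nonnegative functions). -/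
theorem stmt8 (n m : ℕ) (hn : 0 < n) (hnm : n ≤ m) :
    ∃ C : ℝ, 0 < C ∧
      ∀ φ : (Fin n → ℝ) → ℝ, Measurable φ → (∀ x, 0 ≤ φ x) →
        (∫⁻ M : Matrix (Fin n) (Fin m) ℝ, ENNReal.ofReal (φ (svDecr M))) =
          ENNReal.ofReal C *
            ∫⁻ x in {x : Fin n → ℝ | (∀ i j, i ≤ j → x j ≤ x i) ∧ ∀ i, 0 ≤ x i},
              ENNReal.ofReal
                (φ x * ((∏ i, x i ^ (m - n)) *
                  ∏ i, ∏ j ∈ Finset.Ioi i, (x i ^ 2 - x j ^ 2))) := by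
  obtain ⟨C, hC, h⟩ := SVF.main1 n m ⟨0, hn⟩ hnm
  refine ⟨C, hC, fun φ hφ hφ0 => ?_⟩
  have cs : Continuous fun l : Fin n → ℝ => (fun i => Real.sqrt (l i)) := by fun_prop
  have h1 := h (fun l => ENNReal.ofReal (φ (fun i => Real.sqrt (l i))))
    (hφ.comp cs.measurable).ennreal_ofReal
  have e1 : (∫⁻ M : Matrix (Fin n) (Fin m) ℝ, ENNReal.ofReal (φ (svDecr M))) =
      ∫⁻ M : SVF.E n m, ENNReal.ofReal (φ (fun i => Real.sqrt (SVF.ev (Matrix.of M * (Matrix.of M).transpose) i))) := by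
    simp only [SVF.svDecr_eq]
    rfl
  rw [e1, h1]
  congr 1
  refine setLIntegral_congr_fun (SVF.isClosed_Chn n).measurableSet fun x hx => ?_
  have e2 : (fun i => Real.sqrt (SVF.sqm x i)) = x := funext fun i => Real.sqrt_sq (hx.2 i)
  simp only [e2]
  rw [ENNReal.ofReal_mul (hφ0 x)]
  rfl
end

section
/- Let X₁ and X₂ be independent standard normal real random variables and let Z = X₁X₂. Then for every z > 0, the density of Z at z equals (1/π) ∫₀^∞ e^{-z(t^{-2} + t²)/2} · √((1 + t^{-4}) / (t^{-2} + t²)) dt. -/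
open MeasureTheory ProbabilityTheory

/-- integrand of the density: marginal of `x` times the conditional density of `x * Y` at `z`. -/
noncomputable def auxF (x z : ℝ) : ℝ :=
  gaussianPDFReal 0 1 x * gaussianPDFReal 0 (x ^ 2).toNNReal z

lemma auxF_nonneg (x z : ℝ) : 0 ≤ auxF x z :=
  mul_nonneg (gaussianPDFReal_nonneg _ _ _) (gaussianPDFReal_nonneg _ _ _)

lemma auxF_meas : Measurable (fun q : ℝ × ℝ => auxF q.1 q.2) := by
  unfold auxF gaussianPDFReal
  fun_prop

lemma aux_slice (x : ℝ) (hx : x ≠ 0) (s : Set ℝ) (hs : MeasurableSet s) :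
    gaussianReal 0 1 ((fun y => x * y) ⁻¹' s) =
      ∫⁻ z in s, gaussianPDF 0 (x ^ 2).toNNReal z := by
  have h := gaussianReal_map_const_mul (μ := 0) (v := 1) x
  have hv : (x ^ 2).toNNReal ≠ 0 := by
    have : 0 < x ^ 2 := by positivity
    simpa using hx
  rw [← gaussianReal_apply 0 hv, ← Measure.map_apply (by fun_prop) hs, h]
  congr 2
  · simp
  · rw [mul_one]
    ext
    simp [sq_nonneg]

lemma aux_map (s : Set ℝ) (hs : MeasurableSet s) :
    Measure.map (fun x : ℝ × ℝ => x.1 * x.2)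
          ((gaussianReal 0 1).prod (gaussianReal 0 1)) s =
      ∫⁻ z in s, ∫⁻ x, ENNReal.ofReal (auxF x z) := by
  have hm : Measurable (fun x : ℝ × ℝ => x.1 * x.2) := by fun_prop
  rw [Measure.map_apply hm hs, Measure.prod_apply (hm hs)]
  have hne : ∀ᵐ x : ℝ ∂volume, x ≠ 0 := by
    simp [ae_iff]
  have hmg : Measurable fun x : ℝ =>
      gaussianReal 0 1 (Prod.mk x ⁻¹' ((fun x : ℝ × ℝ => x.1 * x.2) ⁻¹' s)) :=
    measurable_measure_prodMk_left (hm hs)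
  have key : ∀ g : ℝ → ENNReal, Measurable g →
      ∫⁻ x, g x ∂(gaussianReal 0 1) = ∫⁻ x, (gaussianPDF 0 1 * g) x := fun g hg => by
    rw [gaussianReal_of_var_ne_zero 0 one_ne_zero,
      lintegral_withDensity_eq_lintegral_mul _ (measurable_gaussianPDF 0 1) hg]
  rw [key _ hmg, lintegral_lintegral_swap]
  · apply lintegral_congr_ae
    filter_upwards [hne] with x hx
    have := aux_slice x hx s hs
    simp only [Pi.mul_apply]
    change _ * gaussianReal 0 1 ((fun y => x * y) ⁻¹' s) = _
    rw [this, ← lintegral_const_mul _ (measurable_gaussianPDF _ _)]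
    refine lintegral_congr fun z => ?_
    rw [auxF, ENNReal.ofReal_mul (gaussianPDFReal_nonneg _ _ _)]
    rfl
  · exact (auxF_meas.comp measurable_swap).ennreal_ofReal.aemeasurable

lemma aux_ae_gen (F : ℝ → ℝ → ℝ) (h0 : ∀ x z, 0 ≤ F x z)
    (hF : Measurable (fun q : ℝ × ℝ => F q.1 q.2))
    (h : ∫⁻ z, ∫⁻ x, ENNReal.ofReal (F x z) ≠ ⊤) :
    ∀ᵐ z : ℝ, ENNReal.ofReal (∫ x, F x z) = ∫⁻ x, ENNReal.ofReal (F x z) := by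
  have hM : Measurable fun z => ∫⁻ x, ENNReal.ofReal (F x z) :=
    Measurable.lintegral_prod_left' (f := fun q : ℝ × ℝ => ENNReal.ofReal (F q.1 q.2))
      hF.ennreal_ofReal
  filter_upwards [ae_lt_top hM h] with z hz
  have hmz : Measurable fun x => F x z :=
    hF.comp (measurable_id.prodMk measurable_const)
  refine ofReal_integral_eq_lintegral_ofReal ?_ (ae_of_all _ fun x => h0 x z)
  refine ⟨hmz.aestronglyMeasurable, ?_⟩
  rw [hasFiniteIntegral_iff_ofReal (ae_of_all _ fun x => h0 x z)]
  exact hz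

lemma aux_ae : ∀ᵐ z : ℝ, ENNReal.ofReal (∫ x, auxF x z) = ∫⁻ x, ENNReal.ofReal (auxF x z) := by
  refine aux_ae_gen auxF auxF_nonneg auxF_meas ?_
  rw [← setLIntegral_univ, ← aux_map Set.univ MeasurableSet.univ]
  exact measure_ne_top _ _

lemma aux_val (z : ℝ) (hz : 0 < z) : ∫ x, auxF x z = (1 / Real.pi) *
          ∫ t in Set.Ioi (0 : ℝ),
            Real.exp (-z * ((t ^ 2)⁻¹ + t ^ 2) / 2) *
              Real.sqrt ((1 + (t ^ 4)⁻¹) / ((t ^ 2)⁻¹ + t ^ 2)) := by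
  have h1 : ∀ x, auxF x z = auxF |x| z := fun x => by
    simp [auxF, gaussianPDFReal]
  rw [show (fun x => auxF x z) = fun x => (fun y => auxF y z) |x| from funext h1]
  rw [integral_comp_abs (f := fun x => auxF x z)]
  have h2 := integral_comp_mul_left_Ioi (fun x => auxF x z) 0 (Real.sqrt_pos.2 hz)
  have hs := Real.sqrt_pos.2 hz
  rw [mul_zero, smul_eq_mul, eq_inv_mul_iff_mul_eq₀ hs.ne'] at h2
  rw [← h2, ← integral_const_mul, ← integral_const_mul, ← integral_const_mul]
  refine setIntegral_congr_fun measurableSet_Ioi fun t ht => ?_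
  have ht : 0 < t := ht
  have e1 : (1 + (t ^ 4)⁻¹) / ((t ^ 2)⁻¹ + t ^ 2) = (t⁻¹) ^ 2 := by
    field_simp
    ring
  have e2 : (√z * t) ^ 2 = z * t ^ 2 := by rw [mul_pow, Real.sq_sqrt hz.le]
  have hp := Real.pi_pos
  have e3 : √(2 * Real.pi * (z * t ^ 2)) = √(2 * Real.pi) * (√z * t) := by
    rw [Real.sqrt_mul (by positivity), Real.sqrt_mul hz.le, Real.sqrt_sq ht.le]
  have e4 : √(2 * Real.pi) * √(2 * Real.pi) = 2 * Real.pi := Real.mul_self_sqrt (by positivity)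
  have e5 : Real.exp (-z * ((t ^ 2)⁻¹ + t ^ 2) / 2) =
      Real.exp (-(z * t ^ 2) / 2) * Real.exp (-z ^ 2 / (2 * (z * t ^ 2))) := by
    rw [← Real.exp_add]
    congr 1
    field_simp
    ring
  simp only [e1, auxF, gaussianPDFReal, e2, e5, Real.sqrt_sq (inv_pos.2 ht).le, sub_zero,
    NNReal.coe_one, mul_one, Real.coe_toNNReal _ (by positivity : 0 ≤ z * t ^ 2), e3]
  have e6 : Real.pi = √(2 * Real.pi) * √(2 * Real.pi) / 2 := by rw [e4]; ring
  have hq : 0 < √(2 * Real.pi) := by positivity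
  generalize √(2 * Real.pi) = q at *
  rw [e6]
  field_simp

/-- if `X₁, X₂` are independent standard normals and `Z = X₁ X₂`, then
`Z` has a density `p` with respect to Lebesgue measure whose value at every `z > 0` is
`(1/π) ∫₀^∞ e^{-z(t⁻² + t²)/2} √((1 + t⁻⁴)/(t⁻² + t²)) dt`.
(The law of `Z` is the pushforward of the product of two standard Gaussians under
multiplication, which encodes the independence.) -/
theorem stmt12 :
    ∃ p : ℝ → ℝ,
      Measure.map (fun x : ℝ × ℝ => x.1 * x.2)
          ((gaussianReal 0 1).prod (gaussianReal 0 1)) =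
        volume.withDensity (fun z => ENNReal.ofReal (p z)) ∧
      ∀ z : ℝ, 0 < z →
        p z = (1 / Real.pi) *
          ∫ t in Set.Ioi (0 : ℝ),
            Real.exp (-z * ((t ^ 2)⁻¹ + t ^ 2) / 2) *
              Real.sqrt ((1 + (t ^ 4)⁻¹) / ((t ^ 2)⁻¹ + t ^ 2)) := by
  refine ⟨fun z => ∫ x, auxF x z, ?_, aux_val⟩
  ext s hs
  rw [aux_map s hs, withDensity_apply _ hs]
  refine lintegral_congr_ae (ae_restrict_of_ae ?_)
  filter_upwards [aux_ae] with z hz using hz.symm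
end
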